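/- arXiv:1205.3460 — 4 statements merged into one kernel-verified Lean document; each statement's English description precedes it below -/
import Mathlib

section
/- Let (M^n, g) be a smooth Riemannian manifold with n ≥ 3 and let T be a Codazzi tensor on M which at every point has exactly two distinct eigenvalues ρ and σ, of multiplicity 1 and n−1 respectively. Let W = { p ∈ M : dσ(p) ≠ 0 }. Then on each connected component of the complement of W̄ = W ∪ ∂W in M, if nonempty, the eigenvalue σ is constant and the component is foliated by totally geodesic hypersurfaces whose tangent spaces are the eigenspaces of T relative to σ. -/
noncomputable section

open scoped RealInnerProductSpace

/-- Euclidean model space `ℝⁿ`. -/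
abbrev E (n : ℕ) : Type := EuclideanSpace ℝ (Fin n)

/-- The `i`-th standard coordinate vector of `ℝⁿ`. -/
noncomputable def e (n : ℕ) (i : Fin n) : E n := EuclideanSpace.single i 1

/-- A smooth Riemannian metric, written in a single coordinate chart `U ⊆ ℝⁿ`, together
with its inverse metric and its Levi-Civita connection (encoded via the Christoffel
symbols `Γ`).  The fields `Γ_symm` (torsion-freeness) and `compat` (metric compatibility)
characterise the Levi-Civita connection uniquely. -/
structure RiemannChart (n : ℕ) where
  U : Set (E n)
  hU : IsOpen U
  g : E n → E n → E n → ℝ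
  g_lin : ∀ p (a : ℝ) u v w, g p (a • u + v) w = a * g p u w + g p v w
  g_symm : ∀ p v w, g p v w = g p w v
  g_posdef : ∀ p ∈ U, ∀ v, v ≠ 0 → 0 < g p v v
  g_smooth : ∀ v w, ContDiffOn ℝ (⊤ : ℕ∞) (fun q => g q v w) U
  ginv : E n → E n → E n → ℝ
  ginv_symm : ∀ p v w, ginv p v w = ginv p w v
  ginv_g : ∀ p ∈ U, ∀ i j : Fin n,
    (∑ k : Fin n, ginv p (e n i) (e n k) * g p (e n k) (e n j)) = if i = j then 1 else 0
  Γ : E n → E n → E n → E n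
  Γ_lin : ∀ p (a : ℝ) u v w, Γ p (a • u + v) w = a • Γ p u w + Γ p v w
  Γ_symm : ∀ p v w, Γ p v w = Γ p w v
  Γ_smooth : ∀ v w, ContDiffOn ℝ (⊤ : ℕ∞) (fun q => Γ q v w) U
  compat : ∀ p ∈ U, ∀ v w u,
    fderiv ℝ (fun q => g q w u) p v = g p (Γ p v w) u + g p w (Γ p v u)

namespace RiemannChart

variable {n : ℕ} (D : RiemannChart n)

/-- Covariant derivative `∇_v Y` of a vector field `Y` at `p`. -/
def covDeriv (Y : E n → E n) (p v : E n) : E n :=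
  fderiv ℝ Y p v + D.Γ p v (Y p)

/-- Covariant derivative `(∇_v T)(w,u)` of a `(0,2)`-tensor field `T` at `p`. -/
def covDeriv2 (T : E n → E n → E n → ℝ) (p v w u : E n) : ℝ :=
  fderiv ℝ (fun q => T q w u) p v - T p (D.Γ p v w) u - T p w (D.Γ p v u)

/-- `T` is a Codazzi tensor on `U`: a smooth symmetric bilinear form whose covariant
derivative is totally symmetric. -/
def IsCodazzi (T : E n → E n → E n → ℝ) : Prop :=
  (∀ p ∈ D.U, ∀ v w, T p v w = T p w v) ∧
  (∀ p ∈ D.U, ∀ (a : ℝ) u v w, T p (a • u + v) w = a * T p u w + T p v w) ∧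
  (∀ v w, ContDiffOn ℝ (⊤ : ℕ∞) (fun q => T q v w) D.U) ∧
  (∀ p ∈ D.U, ∀ v w u, D.covDeriv2 T p v w u = D.covDeriv2 T p w v u)

/-- The eigenspace (as a set) of the symmetric bilinear form `T` with respect to `g`,
at the point `p`, for the eigenvalue `lam`. -/
def eigenSet (T : E n → E n → E n → ℝ) (p : E n) (lam : ℝ) : Set (E n) :=
  {v | ∀ w, T p v w = lam * D.g p v w}

/-- The multiplicity of `lam` as an eigenvalue of `T` with respect to `g` at `p`. -/
def eigenMult (T : E n → E n → E n → ℝ) (p : E n) (lam : ℝ) : ℕ :=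
  Module.finrank ℝ (Submodule.span ℝ (D.eigenSet T p lam))

/-- `T` has, at every point of `U`, exactly the two distinct eigenvalues `ρ p` (of
multiplicity `1`) and `σ p` (of multiplicity `n - 1`). -/
def HasTwoEigenvalues (T : E n → E n → E n → ℝ) (ρ σ : E n → ℝ) : Prop :=
  (∀ p ∈ D.U, ρ p ≠ σ p) ∧
  (∀ p ∈ D.U, D.eigenMult T p (ρ p) = 1) ∧
  (∀ p ∈ D.U, D.eigenMult T p (σ p) = n - 1)

/-- The Riemann curvature tensor `R(v,w)z` at `p`, computed from the Christoffel
symbols by the usual coordinate formula. -/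
def Riem (p v w z : E n) : E n :=
  fderiv ℝ (fun q => D.Γ q w z) p v - fderiv ℝ (fun q => D.Γ q v z) p w
    + D.Γ p v (D.Γ p w z) - D.Γ p w (D.Γ p v z)

/-- The Ricci tensor `Ric(v,w) = tr (z ↦ R(z,v)w)` at `p`. -/
def Ric (p v w : E n) : ℝ := ∑ i : Fin n, D.Riem p (e n i) v w i

/-- The scalar curvature at `p`. -/
def scalar (p : E n) : ℝ :=
  ∑ i : Fin n, ∑ j : Fin n, D.ginv p (e n i) (e n j) * D.Ric p (e n i) (e n j)

/-- The Hessian `∇²f(v,w)` of a function `f` at `p`. -/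
def Hess (f : E n → ℝ) (p v w : E n) : ℝ :=
  fderiv ℝ (fun q => fderiv ℝ f q w) p v - fderiv ℝ f p (D.Γ p v w)

/-- The gradient Ricci soliton equation `Ric + ∇²f = λ g` on `U`. -/
def IsGradientSoliton (f : E n → ℝ) (lam : ℝ) : Prop :=
  ContDiffOn ℝ (⊤ : ℕ∞) f D.U ∧
  ∀ p ∈ D.U, ∀ v w, D.Ric p v w + D.Hess f p v w = lam * D.g p v w

/-- Strictly positive sectional curvature on `U`. -/
def PosSec : Prop :=
  ∀ p ∈ D.U, ∀ v w,
    0 < D.g p v v * D.g p w w - (D.g p v w) ^ 2 → 0 < D.g p (D.Riem p v w w) v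

/-- Nonnegative sectional curvature on `U`. -/
def NonnegSec : Prop :=
  ∀ p ∈ D.U, ∀ v w,
    0 < D.g p v v * D.g p w w - (D.g p v w) ^ 2 → 0 ≤ D.g p (D.Riem p v w w) v

/-- The distribution `Vd` is totally geodesic (autoparallel) at `p`: the covariant
derivative of any vector field tangent to `Vd`, in a direction tangent to `Vd`,
stays tangent to `Vd`. -/
def TotallyGeodesicAt (Vd : E n → Set (E n)) (p : E n) : Prop :=
  ∀ Y : E n → E n, DifferentiableAt ℝ Y p → (∀ q ∈ D.U, Y q ∈ Vd q) →
    ∀ v ∈ Vd p, D.covDeriv Y p v ∈ Vd p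

/-- `S` is an integral hypersurface of the `(n-1)`-dimensional distribution `Vd`:
near each of its points it is a smoothly parametrised hypersurface whose tangent
spaces are given by `Vd`. -/
def IsIntegralHypersurface (Vd : E n → Set (E n)) (S : Set (E n)) : Prop :=
  S ⊆ D.U ∧
  ∀ q ∈ S, ∃ (φ : E (n - 1) → E n) (V : Set (E n)),
    IsOpen V ∧ q ∈ V ∧ V ⊆ D.U ∧ ContDiff ℝ (⊤ : ℕ∞) φ ∧
    (∀ x, φ x ∈ D.U → Set.range (fun u => fderiv ℝ φ x u) = Vd (φ x)) ∧
    S ∩ V = Set.range φ ∩ V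

/-- On the subset `A ⊆ U`, around each of its points the metric is isometric to a
warped product `dt² + w(t)² h` of an `(n-1)`-dimensional Riemannian manifold `(N,h)`
over an interval `I ⊆ ℝ`; moreover `σ` only depends on the interval variable and
the tangent spaces of the warping hypersurfaces (the `t = const` leaves) are
prescribed by the distribution `Vd`. -/
def LocallyWarpedProductOn (A : Set (E n)) (σ : E n → ℝ) (Vd : E n → Set (E n)) : Prop :=
  ∀ p ∈ A, ∃ (V : Set (E n)) (φ : E n → ℝ × E (n - 1)) (I : Set ℝ) (N : Set (E (n - 1)))
      (w : ℝ → ℝ) (h : E (n - 1) → E (n - 1) → E (n - 1) → ℝ) (s : ℝ → ℝ),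
    IsOpen V ∧ p ∈ V ∧ V ⊆ D.U ∧
    IsOpen I ∧ I.OrdConnected ∧ I.Nonempty ∧ IsOpen N ∧
    ContDiffOn ℝ (⊤ : ℕ∞) φ V ∧ Set.InjOn φ V ∧ φ '' V ⊆ I ×ˢ N ∧
    ContDiff ℝ (⊤ : ℕ∞) w ∧ (∀ t, 0 < w t) ∧
    (∀ x ∈ N, ∀ a b, h x a b = h x b a) ∧
    (∀ x ∈ N, ∀ (c : ℝ) (a a' b : E (n - 1)), h x (c • a + a') b = c * h x a b + h x a' b) ∧
    (∀ x ∈ N, ∀ a, a ≠ 0 → 0 < h x a a) ∧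
    (∀ q ∈ V ∩ A, ∀ v u : E n,
      D.g q v u = (fderiv ℝ φ q v).1 * (fderiv ℝ φ q u).1 +
        (w (φ q).1) ^ 2 * h (φ q).2 (fderiv ℝ φ q v).2 (fderiv ℝ φ q u).2) ∧
    (∀ q ∈ V ∩ A, σ q = s (φ q).1) ∧
    (∀ q ∈ V ∩ A, ∀ v : E n, ((fderiv ℝ φ q v).1 = 0 ↔ v ∈ Vd q))

end RiemannChart

open Set Metric Filter in
theorem norm_le_exp_mul_of_norm_deriv_le {Y : Type*} [NormedAddCommGroup Y] [NormedSpace ℝ Y]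
    {d d' : ℝ → Y} {C ε : ℝ} (hC : 1 ≤ C) (hε : 0 ≤ ε) (h0 : d 0 = 0)
    (hd : ∀ t ∈ Icc (0 : ℝ) 1, HasDerivWithinAt d (d' t) (Icc 0 1) t)
    (hb : ∀ t ∈ Icc (0 : ℝ) 1, ‖d' t‖ ≤ C * ‖d t‖ + ε) :
    ∀ t ∈ Icc (0 : ℝ) 1, ‖d t‖ ≤ Real.exp C * ε := by
  intro t ht
  have h1 := norm_le_gronwallBound_of_norm_deriv_right_le (f := d) (f' := d') (δ := 0)
    (K := C) (ε := ε) (a := 0) (b := 1) (fun s hs => (hd s hs).continuousWithinAt)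
    (fun s hs => (hd s (Ico_subset_Icc_self hs)).mono_of_mem_nhdsWithin
      (mem_of_superset (Icc_mem_nhdsGE hs.2) (Icc_subset_Icc_left hs.1)))
    (by simp [h0]) (fun s hs => hb s (Ico_subset_Icc_self hs)) t ht
  rw [gronwallBound_of_K_ne_0 (by positivity)] at h1
  have h2 : ε / C ≤ ε := div_le_self hε hC
  have h3 : Real.exp (C * (t - 0)) ≤ Real.exp C := by
    apply Real.exp_le_exp.2
    nlinarith [ht.2]
  have h4 : ε / C * (Real.exp (C * (t - 0)) - 1) ≤ ε * Real.exp C := by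
    have : 0 ≤ ε / C := by positivity
    have := Real.exp_pos C
    have : 1 ≤ Real.exp (C * (t - 0)) := Real.one_le_exp (by nlinarith [ht.1])
    apply mul_le_mul h2 <;> linarith
  linarith

section TotalDifferential

variable {X Y : Type*} [NormedAddCommGroup X] [NormedSpace ℝ X]
  [NormedAddCommGroup Y] [NormedSpace ℝ Y]

/-- The solution along the ray through `x` of the total differential equation `df = F(x, f)`. -/
structure IsRaySolution (F : X × Y → X →L[ℝ] Y) (R : ℝ) (x : X) (u : ℝ → Y) : Prop where
  zero : u 0 = 0
  mem : ∀ t ∈ Set.Icc (0 : ℝ) 1, (t • x, u t) ∈ Metric.ball (0 : X × Y) R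
  deriv : ∀ t ∈ Set.Icc (0 : ℝ) 1, HasDerivWithinAt u (F (t • x, u t) x) (Set.Icc 0 1) t

/-- Uniform `C²`-type bounds on a ball together with the Frobenius integrability condition for the
total differential equation `df = F(x, f)`. -/
structure IsIntegrableSystem (F : X × Y → X →L[ℝ] Y) (F' : X × Y → X × Y →L[ℝ] X →L[ℝ] Y)
    (R C : ℝ) : Prop where
  one_le : 1 ≤ C
  hasFDerivAt : ∀ z ∈ Metric.ball (0 : X × Y) R, HasFDerivAt F (F' z) z
  norm_le : ∀ z ∈ Metric.ball (0 : X × Y) R, ‖F z‖ ≤ C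
  norm_le' : ∀ z ∈ Metric.ball (0 : X × Y) R, ‖F' z‖ ≤ C
  norm_sub_le' : ∀ z ∈ Metric.ball (0 : X × Y) R, ∀ w ∈ Metric.ball (0 : X × Y) R,
    ‖F' w - F' z‖ ≤ C * ‖w - z‖
  symm : ∀ z ∈ Metric.ball (0 : X × Y) R, ∀ h k, F' z (h, F z h) k = F' z (k, F z k) h

namespace IsIntegrableSystem

variable {F : X × Y → X →L[ℝ] Y} {F' : X × Y → X × Y →L[ℝ] X →L[ℝ] Y} {R C : ℝ}

theorem norm_sub_le (H : IsIntegrableSystem F F' R C) {z w : X × Y}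
    (hz : z ∈ Metric.ball (0 : X × Y) R) (hw : w ∈ Metric.ball (0 : X × Y) R) :
    ‖F w - F z‖ ≤ C * ‖w - z‖ :=
  (convex_ball _ _).norm_image_sub_le_of_norm_hasFDerivWithin_le
    (fun y hy => (H.hasFDerivAt y hy).hasFDerivWithinAt) H.norm_le' hz hw

theorem norm_sub_sub_le (H : IsIntegrableSystem F F' R C) {z w : X × Y}
    (hz : z ∈ Metric.ball (0 : X × Y) R) (hw : w ∈ Metric.ball (0 : X × Y) R) :
    ‖F w - F z - F' z (w - z)‖ ≤ C * ‖w - z‖ ^ 2 := by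
  have h := ((convex_ball (0 : X × Y) R).inter
    (convex_closedBall z ‖w - z‖)).norm_image_sub_le_of_norm_hasFDerivWithin_le'
    (f := F) (f' := F') (φ := F' z) (C := C * ‖w - z‖) (x := z) (y := w)
    (fun y hy => (H.hasFDerivAt y hy.1).hasFDerivWithinAt)
    (fun y hy => (H.norm_sub_le' z hz y hy.1).trans (by
      have := mem_closedBall_iff_norm.1 hy.2
      have := H.one_le
      gcongr))
    ⟨hz, by simp⟩ ⟨hw, by simp [dist_eq_norm]⟩
  calc _ ≤ _ := h
    _ = _ := by ring

theorem exists_isRaySolution [CompleteSpace Y] (H : IsIntegrableSystem F F' R C) {x : X}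
    (hx : C * ‖x‖ < R) : ∃ u, IsRaySolution F R x u := by
  have hC := H.one_le
  have hxR : ‖x‖ < R := by nlinarith [norm_nonneg x]
  have hmem : ∀ t ∈ Set.Icc (0 : ℝ) 1, ∀ y ∈ Metric.closedBall (0 : Y) (C * ‖x‖),
      (t • x, y) ∈ Metric.ball (0 : X × Y) R := by
    intro t ht y hy
    rw [mem_ball_zero_iff, Prod.norm_def, max_lt_iff]
    refine ⟨?_, (mem_closedBall_zero_iff.1 hy).trans_lt hx⟩
    rw [norm_smul, Real.norm_of_nonneg ht.1]
    nlinarith [norm_nonneg x, ht.2]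
  obtain ⟨L, hL⟩ : ∃ L : NNReal, (L : ℝ) = C * ‖x‖ := ⟨⟨C * ‖x‖, by positivity⟩, rfl⟩
  rw [← hL] at hmem
  have hP : IsPicardLindelof (fun t y => F (t • x, y) x) (tmin := 0) (tmax := 1)
      ⟨0, by simp⟩ (0 : Y) (a := L) (r := 0) (L := L) (K := L) := by
    refine ⟨fun t ht => LipschitzOnWith.of_dist_le_mul fun y hy y' hy' => ?_,
      fun y hy t ht => ?_, fun t ht y hy => ?_, by simp⟩
    · rw [dist_eq_norm, dist_eq_norm, ← sub_apply]
      refine (ContinuousLinearMap.le_opNorm _ _).trans ?_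
      have := H.norm_sub_le (hmem t ht y' hy') (hmem t ht y hy)
      have e : ‖((t • x, y) : X × Y) - (t • x, y')‖ = ‖y - y'‖ := by simp [Prod.norm_def]
      rw [e] at this
      calc _ ≤ C * ‖y - y'‖ * ‖x‖ := by gcongr
        _ = L * ‖y - y'‖ := by rw [hL]; ring
    · have h1 := (H.hasFDerivAt _ (hmem t ht y hy)).continuousAt
      have h2 : ContinuousAt (fun s : ℝ => F (s • x, y)) t :=
        ContinuousAt.comp (f := fun s : ℝ => (s • x, y)) h1 (by fun_prop)
      exact (h2.clm_apply continuousAt_const).continuousWithinAt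
    · exact (ContinuousLinearMap.le_opNorm _ _).trans (by
        have := H.norm_le _ (hmem t ht y hy)
        rw [hL]
        gcongr)
  obtain ⟨α, hα⟩ := ODE.FunSpace.exists_isFixedPt_next hP (x := 0) (by simp)
  have hball : ∀ t, α.compProj t ∈ Metric.closedBall (0 : Y) L :=
    fun t => α.compProj_mem_closedBall hP.mul_max_le
  refine ⟨α.compProj, ?_, fun t ht => hmem t ht _ (hball t), fun t ht => ?_⟩
  · have := ODE.FunSpace.compProj_val (α := α) (t := ⟨0, by simp⟩)
    rw [this, ← hα, ODE.FunSpace.next_apply₀]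
  · refine (ODE.hasDerivWithinAt_picard_Icc (t₀ := 0) (by simp) hP.continuousOn_uncurry
      α.continuous_compProj.continuousOn (fun t _ => hball t) (0 : Y) ht).congr_of_mem ?_ ht
    intro t' ht'
    nth_rw 1 [← hα]
    rw [ODE.FunSpace.compProj_of_mem ht', ODE.FunSpace.next_apply]

theorem exists_norm_sub_le (H : IsIntegrableSystem F F' R C) :
    ∃ B : ℝ, ∀ (x x' : X) (u u' : ℝ → Y), ‖x‖ ≤ 1 → ‖x'‖ ≤ 1 → IsRaySolution F R x u →
      IsRaySolution F R x' u' →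
      ‖u' 1 - u 1 - F (x, u 1) (x' - x)‖ ≤ B * ‖x' - x‖ ^ 2 := by
  have hC := H.one_le
  set A := Real.exp C * (2 * C) with hA
  have hA1 : 1 ≤ A := by
    have : 1 ≤ Real.exp C := Real.one_le_exp (by linarith)
    nlinarith
  refine ⟨Real.exp C * (C * A ^ 2 + C * A), fun x x' u u' hx hx' hu hu' => ?_⟩
  set h := x' - x with hh
  have hz : ∀ t, ((t • x', u' t) : X × Y) - (t • x, u t) = (t • h, u' t - u t) := by
    intro t; simp [hh, smul_sub]
  have hth : ∀ t ∈ Set.Icc (0 : ℝ) 1, ‖t • h‖ ≤ ‖h‖ := by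
    intro t ht
    rw [norm_smul, Real.norm_of_nonneg ht.1]
    nlinarith [norm_nonneg h, ht.2]
  have hlip : ∀ t ∈ Set.Icc (0 : ℝ) 1, ‖u' t - u t‖ ≤ A * ‖h‖ := by
    have := norm_le_exp_mul_of_norm_deriv_le (d := fun t => u' t - u t)
      (d' := fun t => F (t • x', u' t) x' - F (t • x, u t) x) (C := C) (ε := 2 * C * ‖h‖) hC
      (by positivity) (by simp [hu.zero, hu'.zero])
      (fun t ht => (hu'.deriv t ht).sub (hu.deriv t ht)) (fun t ht => ?_)
    · intro t ht
      refine (this t ht).trans (le_of_eq ?_)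
      rw [hA]; ring
    · have e : F (t • x', u' t) x' - F (t • x, u t) x
          = (F (t • x', u' t) - F (t • x, u t)) x' + F (t • x, u t) h := by
        simp [hh]
      rw [e]
      have h1 := H.norm_sub_le (hu.mem t ht) (hu'.mem t ht)
      have h2 : ‖((t • x', u' t) : X × Y) - (t • x, u t)‖ ≤ ‖h‖ + ‖u' t - u t‖ := by
        rw [hz, Prod.norm_def]
        exact max_le ((hth t ht).trans (by simp)) (by simp)
      have h3 : ‖(F (t • x', u' t) - F (t • x, u t)) x'‖ ≤ C * (‖h‖ + ‖u' t - u t‖) * 1 :=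
        (ContinuousLinearMap.le_opNorm _ _).trans (by gcongr; exact h1.trans (by gcongr))
      have h4 : ‖F (t • x, u t) h‖ ≤ C * ‖h‖ :=
        (ContinuousLinearMap.le_opNorm _ _).trans (by
          have := H.norm_le _ (hu.mem t ht)
          gcongr)
      refine (norm_add_le _ _).trans ?_
      linarith
  have hzn : ∀ t ∈ Set.Icc (0 : ℝ) 1,
      ‖((t • x', u' t) : X × Y) - (t • x, u t)‖ ≤ A * ‖h‖ := by
    intro t ht
    rw [hz, Prod.norm_def]
    exact max_le ((hth t ht).trans (by nlinarith [norm_nonneg h])) (hlip t ht)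
  have key := norm_le_exp_mul_of_norm_deriv_le
    (d := fun t => u' t - u t - t • F (t • x, u t) h)
    (d' := fun t => F (t • x', u' t) x' - F (t • x, u t) x -
      (t • F' (t • x, u t) (x, F (t • x, u t) x) h + (1 : ℝ) • F (t • x, u t) h))
    (C := C) (ε := (C * A ^ 2 + C * A) * ‖h‖ ^ 2) hC (by positivity)
    (by simp [hu.zero, hu'.zero]) (fun t ht => ?_) (fun t ht => ?_) 1 (by simp)
  · simp only [one_smul] at key
    rw [mul_assoc]
    exact key
  · have h1 : HasDerivWithinAt (fun s : ℝ => ((s • x, u s) : X × Y)) (x, F (t • x, u t) x)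
        (Set.Icc 0 1) t := by
      refine HasDerivWithinAt.prodMk ?_ (hu.deriv t ht)
      simpa using (hasDerivWithinAt_id t (Set.Icc (0 : ℝ) 1)).smul_const x
    have h2 : HasDerivWithinAt (fun s : ℝ => F (s • x, u s))
        (F' (t • x, u t) (x, F (t • x, u t) x)) (Set.Icc 0 1) t :=
      (H.hasFDerivAt _ (hu.mem t ht)).comp_hasDerivWithinAt t h1
    have h3 := h2.clm_apply (hasDerivWithinAt_const t (Set.Icc (0 : ℝ) 1) h)
    have h4 : HasDerivWithinAt (fun s : ℝ => s • F (s • x, u s) h) _ (Set.Icc 0 1) t :=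
      (hasDerivWithinAt_id t (Set.Icc (0 : ℝ) 1)).smul h3
    refine ((hu'.deriv t ht).sub (hu.deriv t ht)).sub ?_
    simpa using h4
  · have hzt := hu.mem t ht
    have hzt' := hu'.mem t ht
    have hd := hz t
    have hn := hzn t ht
    set z : X × Y := (t • x, u t) with hzdef
    set z' : X × Y := (t • x', u' t)
    have e : F z' x' - F z x - (t • F' z (x, F z x) h + (1 : ℝ) • F z h)
        = (F z' - F z - F' z (z' - z)) x' + F' z (z' - z) h
          + F' z (0, u' t - u t - t • F z h) x := by
      have e1 : ((0, u' t - u t - t • F z h) : X × Y) = (z' - z) - t • (h, F z h) := by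
        rw [hd]; simp
      rw [e1, H.symm z hzt x h, (F' z).map_sub (z' - z), (F' z).map_smul]
      have e2 : x' = x + h := by simp [hh]
      simp only [sub_apply, smul_apply, one_smul]
      clear_value h
      subst e2
      simp only [map_add]
      abel
    rw [e]
    have b1 : ‖(F z' - F z - F' z (z' - z)) x'‖ ≤ C * (A * ‖h‖) ^ 2 * 1 :=
      (ContinuousLinearMap.le_opNorm _ _).trans (by
        gcongr
        exact (H.norm_sub_sub_le hzt hzt').trans (by gcongr))
    have b2 : ‖F' z (z' - z) h‖ ≤ C * (A * ‖h‖) * ‖h‖ :=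
      (ContinuousLinearMap.le_opNorm₂ _ _ _).trans (by
        have := H.norm_le' z hzt
        gcongr)
    have b3 : ‖F' z (0, u' t - u t - t • F z h) x‖ ≤ C * ‖u' t - u t - t • F z h‖ * 1 :=
      (ContinuousLinearMap.le_opNorm₂ _ _ _).trans (by
        have := H.norm_le' z hzt
        gcongr
        simp [Prod.norm_def])
    refine (norm_add₃_le).trans ?_
    nlinarith

end IsIntegrableSystem

end TotalDifferential

theorem ContDiffAt.eventually_norm_lt_add_one {V W : Type*} [NormedAddCommGroup V]
    [NormedSpace ℝ V] [NormedAddCommGroup W] [NormedSpace ℝ W] {n : WithTop ℕ∞} {f : V → W} {x : V}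
    (h : ContDiffAt ℝ n f x) : ∀ᶠ z in nhds x, ‖f z‖ < ‖f x‖ + 1 :=
  h.continuousAt.norm.eventually_lt_const (lt_add_one _)

/-- **Frobenius' theorem** for total differential equations: an integrable system `df = F(x, f)`
has a smooth solution near the origin. -/
theorem exists_hasFDerivAt_of_integrable {X Y : Type*} [NormedAddCommGroup X] [NormedSpace ℝ X]
    [NormedAddCommGroup Y] [NormedSpace ℝ Y] [CompleteSpace Y] {F : X × Y → X →L[ℝ] Y}
    {O : Set (X × Y)} (hO : IsOpen O) (h0 : 0 ∈ O) (hF : ContDiffOn ℝ (⊤ : ℕ∞) F O)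
    (hs : ∀ z ∈ O, ∀ h k, fderiv ℝ F z (h, F z h) k = fderiv ℝ F z (k, F z k) h) :
    ∃ r > 0, ∃ f : X → Y, f 0 = 0 ∧ ContDiffOn ℝ (⊤ : ℕ∞) f (Metric.ball 0 r) ∧
      ∀ x ∈ Metric.ball 0 r, (x, f x) ∈ O ∧ HasFDerivAt f (F (x, f x)) x := by
  have hF0 : ContDiffAt ℝ (⊤ : ℕ∞) F 0 := hF.contDiffAt (hO.mem_nhds h0)
  have hF1 : ContDiffAt ℝ 1 (fderiv ℝ F) 0 := hF0.fderiv_right (by norm_cast)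
  obtain ⟨K, S, hS, hK⟩ := hF1.exists_lipschitzOnWith
  have e1 := hF0.eventually_norm_lt_add_one
  have e2 := hF1.eventually_norm_lt_add_one
  obtain ⟨R, hR, hRs⟩ := Metric.eventually_nhds_iff_ball.1
    (((hO.eventually_mem h0).and hS).and (e1.and e2))
  set C := 1 + K + (‖F 0‖ + 1) + (‖fderiv ℝ F 0‖ + 1) with hC
  have n1 := norm_nonneg (F 0)
  have n2 := norm_nonneg (fderiv ℝ F 0)
  have n3 : (0 : ℝ) ≤ K := K.2
  have H : IsIntegrableSystem F (fderiv ℝ F) R C :=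
    { one_le := by linarith
      hasFDerivAt := fun z hz => ((hF.contDiffAt (hO.mem_nhds (hRs z hz).1.1)).differentiableAt
        (by simp)).hasFDerivAt
      norm_le := fun z hz => by linarith [(hRs z hz).2.1]
      norm_le' := fun z hz => by linarith [(hRs z hz).2.2]
      norm_sub_le' := fun z hz w hw => (hK.norm_sub_le (hRs w hw).1.2 (hRs z hz).1.2).trans (by
        gcongr; linarith)
      symm := fun z hz => hs z (hRs z hz).1.1 }
  have hC0 : 0 < C := by linarith
  obtain ⟨r, hr, hr1, hrR⟩ : ∃ r > 0, r ≤ 1 ∧ C * r ≤ R :=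
    ⟨min 1 (R / C), by positivity, min_le_left _ _, by
      calc C * min 1 (R / C) ≤ C * (R / C) := by gcongr; exact min_le_right _ _
        _ = R := by field_simp⟩
  have hex : ∀ x : X, ∃ u : ℝ → Y, x ∈ Metric.ball (0 : X) r → IsRaySolution F R x u := by
    intro x
    by_cases hx : x ∈ Metric.ball (0 : X) r
    · obtain ⟨u, hu⟩ := H.exists_isRaySolution (x := x) (by
        rw [mem_ball_zero_iff] at hx
        nlinarith)
      exact ⟨u, fun _ => hu⟩
    · exact ⟨0, fun h => absurd h hx⟩
  choose u hu using hex
  obtain ⟨B, hB⟩ := H.exists_norm_sub_le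
  have hmem : ∀ x ∈ Metric.ball (0 : X) r, (x, u x 1) ∈ O := fun x hx => by
    have := (hu x hx).mem 1 (by simp)
    rw [one_smul] at this
    exact (hRs _ this).1.1
  have hder : ∀ x ∈ Metric.ball (0 : X) r,
      HasFDerivAt (fun x => u x 1) (F (x, u x 1)) x := by
    intro x hx
    apply HasFDerivAt.of_isLittleO
    have hO2 : (fun x' => u x' 1 - u x 1 - F (x, u x 1) (x' - x)) =O[nhds x]
        fun x' => ‖x' - x‖ ^ 2 := by
      refine Asymptotics.IsBigO.of_bound B ?_
      filter_upwards [Metric.isOpen_ball.mem_nhds hx] with x' hx'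
      rw [Real.norm_of_nonneg (by positivity)]
      exact hB x x' _ _ ((mem_ball_zero_iff.1 hx).le.trans hr1)
        ((mem_ball_zero_iff.1 hx').le.trans hr1) (hu x hx) (hu x' hx')
    refine hO2.trans_isLittleO ?_
    have := Asymptotics.isLittleO_pow_sub_sub x (m := 2) (by norm_num)
    exact this
  have hsm : ContDiffOn ℝ (⊤ : ℕ∞) (fun x => u x 1) (Metric.ball 0 r) := by
    rw [contDiffOn_infty]
    intro n
    induction n with
    | zero =>
      exact contDiffOn_zero.2 fun x hx => (hder x hx).continuousAt.continuousWithinAt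
    | succ n ih =>
      rw [Nat.cast_succ, contDiffOn_succ_iff_fderiv_of_isOpen Metric.isOpen_ball]
      refine ⟨fun x hx => (hder x hx).differentiableAt.differentiableWithinAt, by simp, ?_⟩
      refine ContDiffOn.congr ?_ fun x hx => (hder x hx).fderiv
      exact (hF.of_le (by exact_mod_cast le_top)).comp (contDiffOn_id.prodMk ih) hmem
  refine ⟨r, hr, fun x => u x 1, ?_, hsm, fun x hx => ⟨hmem x hx, hder x hx⟩⟩
  have h := hu 0 (Metric.mem_ball_self hr)
  have := norm_le_exp_mul_of_norm_deriv_le (C := 1) (ε := 0) le_rfl le_rfl h.zero h.deriv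
    (fun t _ => by simp) 1 (by simp)
  simpa using this

theorem surjective_fderiv_univBall {X : Type*} [NormedAddCommGroup X] [InnerProductSpace ℝ X]
    {r : ℝ} (hr : 0 < r) (x : X) :
    Function.Surjective (fderiv ℝ (OpenPartialHomeomorph.univBall (0 : X) r) x) := by
  set Φ := OpenPartialHomeomorph.univBall (0 : X) r with hΦ
  have htar : Φ.target = Metric.ball 0 r := OpenPartialHomeomorph.univBall_target 0 hr
  have hy : Φ x ∈ Metric.ball (0 : X) r := by
    rw [← htar]; exact Φ.map_source (by simp [hΦ])
  have h1 : HasFDerivAt Φ (fderiv ℝ Φ x) (Φ.symm (Φ x)) := by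
    rw [Φ.left_inv (by simp [hΦ])]
    exact ((OpenPartialHomeomorph.contDiff_univBall (n := 1)).differentiable
      (by simp) x).hasFDerivAt
  have h2 : HasFDerivAt Φ.symm (fderiv ℝ Φ.symm (Φ x)) (Φ x) :=
    (((OpenPartialHomeomorph.contDiffOn_univBall_symm (n := 1)).contDiffAt
      (Metric.isOpen_ball.mem_nhds hy)).differentiableAt (by simp)).hasFDerivAt
  have h3 := h1.comp (Φ x) h2
  have h4 : HasFDerivAt (Φ ∘ Φ.symm) (ContinuousLinearMap.id ℝ X) (Φ x) := by
    refine (hasFDerivAt_id (Φ x)).congr_of_eventuallyEq ?_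
    filter_upwards [Metric.isOpen_ball.mem_nhds hy] with y hy
    exact Φ.right_inv (by rwa [htar])
  intro k
  exact ⟨fderiv ℝ Φ.symm (Φ x) k, DFunLike.congr_fun (h3.unique h4) k⟩

/-- **Frobenius' theorem** in codimension one: a `1`-form `α` such that `dα` vanishes on `ker α`
has an integral hypersurface through every point where it is nonzero. -/
theorem exists_integral_hypersurface {X V : Type*} [NormedAddCommGroup X] [InnerProductSpace ℝ X]
    [NormedAddCommGroup V] [NormedSpace ℝ V] (L : (X × ℝ) ≃L[ℝ] V)
    {Ω : Set V} (hΩ : IsOpen Ω) {α : V → V →L[ℝ] ℝ} (hα : ContDiffOn ℝ (⊤ : ℕ∞) α Ω)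
    (hL : ∀ z ∈ Ω, α z (L (0, 1)) ≠ 0)
    (hint : ∀ z ∈ Ω, ∀ v w, α z v = 0 → α z w = 0 → fderiv ℝ α z v w = fderiv ℝ α z w v)
    {q : V} (hq : q ∈ Ω) :
    ∃ φ : X → V, ContDiff ℝ (⊤ : ℕ∞) φ ∧ φ 0 = q ∧ ∀ x, φ x ∈ Ω ∧
      Set.range (fderiv ℝ φ x) = {v | α (φ x) v = 0} := by
  set ψ : X × ℝ → V := fun z => q + L z with hψ
  have hψs : ContDiff ℝ (⊤ : ℕ∞) ψ := contDiff_const.add L.contDiff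
  have hψd : ∀ z, HasFDerivAt ψ (L : X × ℝ →L[ℝ] V) z := fun z => L.hasFDerivAt.const_add q
  set O := ψ ⁻¹' Ω
  have hO : IsOpen O := hΩ.preimage hψs.continuous
  set F : X × ℝ → X →L[ℝ] ℝ := fun z => -((α (ψ z) (L (0, 1)))⁻¹ •
    (α (ψ z)).comp ((L : X × ℝ →L[ℝ] V).comp (ContinuousLinearMap.inl ℝ X ℝ))) with hFdef
  have hαψ : ContDiffOn ℝ (⊤ : ℕ∞) (fun z => α (ψ z)) O :=
    hα.comp hψs.contDiffOn (Set.mapsTo_preimage _ _)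
  have hF : ContDiffOn ℝ (⊤ : ℕ∞) F O :=
    (((hαψ.clm_apply contDiffOn_const).inv fun z hz => hL _ hz).smul
      (hαψ.clm_comp contDiffOn_const)).neg
  have hsplit : ∀ (k : X) (c : ℝ), L (k, c) = L (k, 0) + c • L (0, 1) := fun k c => by
    rw [← map_smul, ← map_add]; simp
  have hker : ∀ z ∈ O, ∀ k, α (ψ z) (L (k, F z k)) = 0 := by
    intro z hz k
    rw [hsplit, map_add, map_smul]
    have := hL _ hz
    simp [hFdef]
    field_simp
    ring
  have hsymm : ∀ z ∈ O, ∀ h k, fderiv ℝ F z (h, F z h) k = fderiv ℝ F z (k, F z k) h := by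
    intro z hz
    have hFd : HasFDerivAt F (fderiv ℝ F z) z :=
      ((hF.contDiffAt (hO.mem_nhds hz)).differentiableAt (by simp)).hasFDerivAt
    have hαd : HasFDerivAt (fun z => α (ψ z)) _ z :=
      HasFDerivAt.comp z (((hα.contDiffAt (hΩ.mem_nhds hz)).differentiableAt
        (by simp)).hasFDerivAt) (hψd z)
    have main : ∀ v k, fderiv ℝ α (ψ z) (L v) (L (k, F z k))
        + fderiv ℝ F z v k * α (ψ z) (L (0, 1)) = 0 := by
      intro v k
      have h1 : HasFDerivAt (fun z => F z k) _ z := hFd.clm_apply (hasFDerivAt_const k z)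
      have h2 : HasFDerivAt (fun z => L (k, F z k)) _ z :=
        HasFDerivAt.comp z (L.hasFDerivAt (x := (k, F z k))) ((hasFDerivAt_const k z).prodMk h1)
      have h3 := hαd.clm_apply h2
      have h4 : HasFDerivAt (fun z => α (ψ z) (L (k, F z k))) (0 : X × ℝ →L[ℝ] ℝ) z := by
        refine (hasFDerivAt_const (0 : ℝ) z).congr_of_eventuallyEq ?_
        filter_upwards [hO.mem_nhds hz] with y hy
        exact hker y hy k
      have h5 := DFunLike.congr_fun (h3.unique h4) v
      have h6 := hsplit 0 (fderiv ℝ F z v k)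
      rw [show ((0 : X), (0 : ℝ)) = 0 from rfl, map_zero, zero_add] at h6
      simp [h6] at h5
      linarith
    intro h k
    have m1 := main (h, F z h) k
    have m2 := main (k, F z k) h
    rw [hint _ hz _ _ (hker z hz h) (hker z hz k)] at m1
    exact mul_right_cancel₀ (hL _ hz) (by linarith)
  obtain ⟨r, hr, f, hf0, hfs, hf⟩ :=
    exists_hasFDerivAt_of_integrable hO (by simpa [O, hψ] using hq) hF hsymm
  set Φ := OpenPartialHomeomorph.univBall (0 : X) r with hΦ
  have hΦs : ContDiff ℝ (⊤ : ℕ∞) Φ := OpenPartialHomeomorph.contDiff_univBall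
  have hmem : ∀ x, Φ x ∈ Metric.ball (0 : X) r := fun x => by
    rw [← OpenPartialHomeomorph.univBall_target 0 hr]
    exact Φ.map_source (by simp [hΦ])
  refine ⟨fun x => ψ (Φ x, f (Φ x)), ?_, by simp [hΦ, hψ, hf0], fun x => ⟨(hf _ (hmem x)).1, ?_⟩⟩
  · refine hψs.comp (hΦs.prodMk ?_)
    rw [← contDiffOn_univ] at hΦs ⊢
    exact hfs.comp hΦs fun x _ => hmem x
  · obtain ⟨hO', hfd⟩ := hf _ (hmem x)
    have hΦd : HasFDerivAt Φ (fderiv ℝ Φ x) x := (hΦs.differentiable (by simp) x).hasFDerivAt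
    have hpd : HasFDerivAt (fun x => (Φ x, f (Φ x))) _ x := hΦd.prodMk (hfd.comp x hΦd)
    have hφd := HasFDerivAt.comp (g := ψ) (f := fun x => (Φ x, f (Φ x))) x (hψd _) hpd
    have happ : ∀ u, fderiv ℝ (fun x => ψ (Φ x, f (Φ x))) x u =
        L (fderiv ℝ Φ x u, F (Φ x, f (Φ x)) (fderiv ℝ Φ x u)) := by
      intro u
      refine (DFunLike.congr_fun hφd.fderiv u).trans ?_
      simp
    ext v
    constructor
    · rintro ⟨u, rfl⟩
      rw [happ]
      exact hker _ hO' _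
    · intro hv
      obtain ⟨⟨k, c⟩, rfl⟩ := L.surjective v
      obtain ⟨u, rfl⟩ := surjective_fderiv_univBall hr x k
      refine ⟨u, ?_⟩
      rw [happ]
      have h1 := hker _ hO' (fderiv ℝ Φ x u)
      have h2 : α (ψ (Φ x, f (Φ x))) (L (fderiv ℝ Φ x u, c)) = 0 := hv
      rw [hsplit, map_add, map_smul, smul_eq_mul] at h1 h2
      have hc : F (Φ x, f (Φ x)) (fderiv ℝ Φ x u) = c :=
        mul_right_cancel₀ (hL _ hO') (by linarith)
      rw [hc]

theorem ContDiffOn.smul_right_const {V W : Type*} [NormedAddCommGroup V] [NormedSpace ℝ V]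
    [NormedAddCommGroup W] [NormedSpace ℝ W] {f : V → ℝ} {s : Set V} {k : WithTop ℕ∞}
    (hf : ContDiffOn ℝ k f s) (c : W) : ContDiffOn ℝ k (fun x => f x • c) s :=
  hf.smul contDiffOn_const

section RankOne

variable {V : Type*} [NormedAddCommGroup V] [NormedSpace ℝ V] {B : V → V →L[ℝ] V →L[ℝ] ℝ}

theorem HasFDerivAt.bilin_apply {B' : V →L[ℝ] V →L[ℝ] V →L[ℝ] ℝ} {p : V}
    (hB : HasFDerivAt B B' p) (u w : V) :
    HasFDerivAt (fun z => B z u w) ((B'.flip u).flip w) p := by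
  have h := (hB.clm_apply (hasFDerivAt_const u p)).clm_apply (hasFDerivAt_const w p)
  refine h.congr_fderiv ?_
  ext v
  simp

/-- The derivative of a field of rank one symmetric forms vanishes on pairs of kernel vectors. -/
theorem fderiv_apply_apply_eq_zero_of_rank_one {p x₀ : V} (hB : DifferentiableAt ℝ B p)
    (hx₀ : B p x₀ x₀ ≠ 0)
    (hr : ∀ᶠ z in nhds p, ∀ u v, B z u v * B z x₀ x₀ = B z u x₀ * B z v x₀)
    {u v : V} (hu : B p u = 0) (hv : B p v = 0) (w : V) : fderiv ℝ B p w u v = 0 := by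
  have d := hB.hasFDerivAt.bilin_apply
  have h1 := (d u v).mul (d x₀ x₀)
  have h2 := (d u x₀).mul (d v x₀)
  have h3 := h1.congr_of_eventuallyEq (hr.mono fun z hz => (hz u v).symm)
  have h4 := DFunLike.congr_fun (h3.unique h2) w
  simp [hu, hv] at h4
  exact h4.resolve_left hx₀

end RankOne

namespace RiemannChart

variable {n : ℕ} (D : RiemannChart n)

/-- The form `T - σ g`, as a field of continuous bilinear forms. -/
def shifted (T : E n → E n → E n → ℝ) (σ : E n → ℝ) (p : E n) : E n →L[ℝ] E n →L[ℝ] ℝ :=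
  ∑ i, ∑ j, (T p (e n i) (e n j) - σ p * D.g p (e n i) (e n j)) •
    (EuclideanSpace.proj (𝕜 := ℝ) i : E n →L[ℝ] ℝ).smulRight
      (EuclideanSpace.proj (𝕜 := ℝ) j : E n →L[ℝ] ℝ)

variable {D} {T : E n → E n → E n → ℝ} {ρ σ : E n → ℝ} {p : E n}

theorem shifted_apply (hT : D.IsCodazzi T) (hp : p ∈ D.U) (v w : E n) :
    D.shifted T σ p v w = T p v w - σ p * D.g p v w := by
  have hTl := hT.2.1 p hp
  have hTs := hT.1 p hp
  have hgl := D.g_lin p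
  have hgs := D.g_symm p
  have z1 : ∀ w, T p 0 w = 0 := fun w => by have := hTl 1 0 0 w; simp at this; exact this
  have z2 : ∀ w, D.g p 0 w = 0 := fun w => by have := hgl 1 0 0 w; simp at this; exact this
  have a1 : ∀ u v w, T p (u + v) w = T p u w + T p v w := fun u v w => by
    simpa using hTl 1 u v w
  have a2 : ∀ u v w, D.g p (u + v) w = D.g p u w + D.g p v w := fun u v w => by
    simpa using hgl 1 u v w
  have s1 : ∀ (a : ℝ) u w, T p (a • u) w = a * T p u w := fun a u w => by
    simpa [z1] using hTl a u 0 w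
  have s2 : ∀ (a : ℝ) u w, D.g p (a • u) w = a * D.g p u w := fun a u w => by
    simpa [z2] using hgl a u 0 w
  set b : E n →ₗ[ℝ] E n →ₗ[ℝ] ℝ := LinearMap.mk₂ ℝ (fun v w => T p v w - σ p * D.g p v w)
    (fun u v w => by simp only [a1, a2]; ring) (fun a u w => by simp only [s1, s2, smul_eq_mul]; ring)
    (fun u v w => by rw [hTs, hgs, a1, a2, hTs v, hTs w, hgs v, hgs w]; ring)
    (fun a u w => by rw [hTs, hgs, s1, s2, hTs w, hgs w, smul_eq_mul]; ring) with hb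
  have hexp : ∀ v w, D.shifted T σ p v w = ∑ i, ∑ j,
      (T p (e n i) (e n j) - σ p * D.g p (e n i) (e n j)) * (v i * w j) := by
    simp [shifted]
  have key : ((D.shifted T σ p).toLinearMap₁₂) = b := by
    refine LinearMap.ext_basis (EuclideanSpace.basisFun (Fin n) ℝ).toBasis
      (EuclideanSpace.basisFun (Fin n) ℝ).toBasis fun i j => ?_
    change D.shifted T σ p _ _ = _
    rw [hexp]
    simp [hb, e]
  have := congrArg (fun l => l v w) key
  simpa [hb] using this

theorem shifted_symm (hT : D.IsCodazzi T) (hp : p ∈ D.U) (v w : E n) :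
    D.shifted T σ p v w = D.shifted T σ p w v := by
  rw [shifted_apply hT hp, shifted_apply hT hp, hT.1 p hp v w, D.g_symm p v w]

theorem contDiffOn_shifted (hT : D.IsCodazzi T) (hσ : ContDiffOn ℝ (⊤ : ℕ∞) σ D.U) :
    ContDiffOn ℝ (⊤ : ℕ∞) (D.shifted T σ) D.U :=
  ContDiffOn.sum fun _ _ => ContDiffOn.sum fun _ _ =>
    ((hT.2.2.1 _ _).sub (hσ.mul (D.g_smooth _ _))).smul_right_const _

theorem mem_eigenSet_iff (hT : D.IsCodazzi T) (hp : p ∈ D.U) {v : E n} :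
    v ∈ D.eigenSet T p (σ p) ↔ D.shifted T σ p v = 0 := by
  rw [eigenSet, Set.mem_ofPred_eq, ContinuousLinearMap.ext_iff]
  simp only [shifted_apply hT hp, zero_apply, sub_eq_zero]

theorem exists_shifted_self_ne_zero (hT : D.IsCodazzi T) (h2 : D.HasTwoEigenvalues T ρ σ)
    (hp : p ∈ D.U) : ∃ x, D.shifted T σ p x x ≠ 0 := by
  obtain ⟨x, hx, hx0⟩ : ∃ x ∈ D.eigenSet T p (ρ p), x ≠ 0 := by
    by_contra! h
    have h1 := h2.2.1 p hp
    rw [eigenMult, Submodule.span_eq_bot.2 h, finrank_bot] at h1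
    exact zero_ne_one h1
  refine ⟨x, ?_⟩
  rw [shifted_apply hT hp, hx x, ← sub_mul]
  exact mul_ne_zero (sub_ne_zero.2 (h2.1 p hp)) (D.g_posdef p hp x hx0).ne'

theorem shifted_eq_zero_iff (hT : D.IsCodazzi T) (h2 : D.HasTwoEigenvalues T ρ σ)
    (hp : p ∈ D.U) {x : E n} (hx : D.shifted T σ p x x ≠ 0) {v : E n} :
    D.shifted T σ p v = 0 ↔ D.shifted T σ p x v = 0 := by
  set b := D.shifted T σ p with hb
  have hspan : Submodule.span ℝ (D.eigenSet T p (σ p)) = LinearMap.ker b.toLinearMap := by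
    rw [← Submodule.span_eq (LinearMap.ker b.toLinearMap)]
    congr 1
    ext v
    simp [mem_eigenSet_iff hT hp, hb]
  have h3 := h2.2.2 p hp
  rw [eigenMult, hspan] at h3
  have hne : (b x).toLinearMap ≠ 0 := fun h => hx (DFunLike.congr_fun h x)
  have h4 := Module.Dual.finrank_ker_add_one_of_ne_zero hne
  have hle : LinearMap.ker b.toLinearMap ≤ LinearMap.ker (b x).toLinearMap := fun v hv => by
    have hv' : b v = 0 := hv
    change b x v = 0
    rw [hb, shifted_symm hT hp, ← hb, hv', zero_apply]
  have heq := Submodule.eq_of_le_of_finrank_eq hle (by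
    rw [finrank_euclideanSpace_fin] at h4
    omega)
  exact SetLike.ext_iff.1 heq v

theorem shifted_mul_shifted (hT : D.IsCodazzi T) (h2 : D.HasTwoEigenvalues T ρ σ)
    (hp : p ∈ D.U) {x : E n} (hx : D.shifted T σ p x x ≠ 0) (u v : E n) :
    D.shifted T σ p u v * D.shifted T σ p x x = D.shifted T σ p u x * D.shifted T σ p v x := by
  have h : D.shifted T σ p (D.shifted T σ p x x • u - D.shifted T σ p x u • x) = 0 := by
    rw [shifted_eq_zero_iff hT h2 hp hx]
    simp [mul_comm]
  have h' := DFunLike.congr_fun h v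
  simp only [map_sub, map_smul, sub_apply, smul_apply, smul_eq_mul, zero_apply] at h'
  rw [shifted_symm hT hp u x, shifted_symm hT hp v x]
  linarith

theorem fderiv_shifted_apply (hT : D.IsCodazzi T) (hσ : ContDiffOn ℝ (⊤ : ℕ∞) σ D.U)
    (hp : p ∈ D.U) (hσp : fderiv ℝ σ p = 0) (v w u : E n) :
    fderiv ℝ (D.shifted T σ) p v w u =
      fderiv ℝ (fun q => T q w u) p v - σ p * fderiv ℝ (fun q => D.g q w u) p v := by
  have hU := D.hU.mem_nhds hp
  have h1 := (((contDiffOn_shifted hT hσ).contDiffAt hU).differentiableAt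
    (by simp)).hasFDerivAt.bilin_apply w u
  have h2 := (((hT.2.2.1 w u).contDiffAt hU).differentiableAt (by simp)).hasFDerivAt
  have h3 := (((D.g_smooth w u).contDiffAt hU).differentiableAt (by simp)).hasFDerivAt
  have h4 := ((hσ.contDiffAt hU).differentiableAt (by simp)).hasFDerivAt
  have h5 := h2.sub (h4.mul h3)
  have h6 := h5.congr_of_eventuallyEq (f₁ := fun z => D.shifted T σ z w u) (by
    filter_upwards [hU] with z hz
    exact shifted_apply hT hz w u)
  have := DFunLike.congr_fun (h1.unique h6) v
  simpa [hσp] using this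

/-- Where `dσ = 0`, the form `T - σ g` satisfies the Codazzi equation. -/
theorem codazzi_shifted (hT : D.IsCodazzi T) (hσ : ContDiffOn ℝ (⊤ : ℕ∞) σ D.U)
    (hp : p ∈ D.U) (hσp : fderiv ℝ σ p = 0) (v w u : E n) :
    fderiv ℝ (D.shifted T σ) p v w u - D.shifted T σ p w (D.Γ p v u) =
      fderiv ℝ (D.shifted T σ) p w v u - D.shifted T σ p v (D.Γ p w u) := by
  have h := hT.2.2.2 p hp v w u
  rw [covDeriv2, covDeriv2, D.Γ_symm p w v] at h
  have c1 := D.compat p hp v w u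
  have c2 := D.compat p hp w v u
  rw [D.Γ_symm p w v] at c2
  simp only [fderiv_shifted_apply hT hσ hp hσp, shifted_apply hT hp, c1, c2]
  linarith

theorem fderiv_shifted_symm (hT : D.IsCodazzi T) (hσ : ContDiffOn ℝ (⊤ : ℕ∞) σ D.U)
    (hp : p ∈ D.U) (v w u : E n) :
    fderiv ℝ (D.shifted T σ) p v w u = fderiv ℝ (D.shifted T σ) p v u w := by
  have hU := D.hU.mem_nhds hp
  have hd := (((contDiffOn_shifted hT hσ).contDiffAt hU).differentiableAt
    (by simp)).hasFDerivAt.bilin_apply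
  refine DFunLike.congr_fun ((hd w u).unique ((hd u w).congr_of_eventuallyEq ?_)) v
  filter_upwards [hU] with z hz
  exact shifted_symm hT hz w u

theorem eventually_shifted_ne_zero (hT : D.IsCodazzi T) (hσ : ContDiffOn ℝ (⊤ : ℕ∞) σ D.U)
    (hp : p ∈ D.U) {x : E n} (hx : D.shifted T σ p x x ≠ 0) :
    ∀ᶠ z in nhds p, D.shifted T σ z x x ≠ 0 := by
  have h := (((contDiffOn_shifted hT hσ).contDiffAt (D.hU.mem_nhds hp)).differentiableAt
    (by simp)).hasFDerivAt.bilin_apply x x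
  exact h.continuousAt.eventually_ne hx

/-- Where `dσ = 0`, the `σ`-eigendistribution is totally geodesic. -/
theorem totallyGeodesicAt_eigenSet (hT : D.IsCodazzi T) (h2 : D.HasTwoEigenvalues T ρ σ)
    (hσ : ContDiffOn ℝ (⊤ : ℕ∞) σ D.U) (hp : p ∈ D.U) (hσp : fderiv ℝ σ p = 0) :
    D.TotallyGeodesicAt (fun r => D.eigenSet T r (σ r)) p := by
  intro Y hY hYt v hv
  have hU := D.hU.mem_nhds hp
  have hd := ((contDiffOn_shifted hT hσ).contDiffAt hU).differentiableAt (by simp)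
  obtain ⟨x, hx⟩ := exists_shifted_self_ne_zero hT h2 hp
  have hr : ∀ᶠ z in nhds p, ∀ u v, D.shifted T σ z u v * D.shifted T σ z x x =
      D.shifted T σ z u x * D.shifted T σ z v x := by
    filter_upwards [hU, eventually_shifted_ne_zero hT hσ hp hx] with z hz hzx u v
    exact shifted_mul_shifted hT h2 hz hzx u v
  have hv0 := (mem_eigenSet_iff hT hp).1 hv
  have hY0 := (mem_eigenSet_iff hT hp).1 (hYt p hp)
  refine (mem_eigenSet_iff hT hp).2 (ContinuousLinearMap.ext fun w => ?_)
  have h1 := hd.hasFDerivAt.clm_apply hY.hasFDerivAt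
  have h3 := h1.unique ((hasFDerivAt_const (0 : E n →L[ℝ] ℝ) p).congr_of_eventuallyEq (by
    filter_upwards [hU] with z hz
    exact (mem_eigenSet_iff hT hz).1 (hYt z hz)))
  have h4 := DFunLike.congr_fun (DFunLike.congr_fun h3 v) w
  have h5 := codazzi_shifted hT hσ hp hσp v w (Y p)
  have h6 := fderiv_apply_apply_eq_zero_of_rank_one hd hx hr hv0 hY0 w
  rw [fderiv_shifted_symm hT hσ hp v w, h6, hv0, shifted_symm hT hp w] at h5
  simp at h4 h5
  simp only [covDeriv, map_add, add_apply, zero_apply]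
  linarith

end RiemannChart

namespace RiemannChart

variable {n : ℕ} (D : RiemannChart n) {T : E n → E n → E n → ℝ} {ρ σ : E n → ℝ}

/-- On an open set where `dσ = 0`, the `σ`-eigendistribution is integrable. -/
theorem exists_isIntegralHypersurface (hT : D.IsCodazzi T) (h2 : D.HasTwoEigenvalues T ρ σ)
    (hσ : ContDiffOn ℝ (⊤ : ℕ∞) σ D.U) (hn : n ≠ 0) {K : Set (E n)} (hK : IsOpen K)
    (hKU : K ⊆ D.U) (hdσ : ∀ z ∈ K, fderiv ℝ σ z = 0) {q : E n} (hq : q ∈ K) :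
    ∃ S : Set (E n), q ∈ S ∧ S ⊆ K ∧
      D.IsIntegralHypersurface (fun r => D.eigenSet T r (σ r)) S := by
  have hB := contDiffOn_shifted hT hσ
  obtain ⟨x, hx⟩ := exists_shifted_self_ne_zero hT h2 (hKU hq)
  have hx0 : x ≠ 0 := by
    rintro rfl
    simp at hx
  obtain ⟨L, hL⟩ : ∃ L : (E (n - 1) × ℝ) ≃L[ℝ] E n, L (0, 1) = x := by
    let L₀ : (E (n - 1) × ℝ) ≃L[ℝ] E n := ContinuousLinearEquiv.ofFinrankEq (by
      simp
      omega)
    obtain ⟨A, hA⟩ := SeparatingDual.exists_continuousLinearEquiv_apply_eq (R := ℝ)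
      (x := L₀ (0, 1)) (y := x) (by simp) hx0
    exact ⟨L₀.trans A, hA⟩
  have hΩ : IsOpen (K ∩ {z | D.shifted T σ z x x ≠ 0}) := isOpen_iff_mem_nhds.2 fun z hz =>
    Filter.inter_mem (hK.mem_nhds hz.1) (eventually_shifted_ne_zero hT hσ (hKU hz.1) hz.2)
  have hα : ContDiffOn ℝ (⊤ : ℕ∞) (fun z => D.shifted T σ z x)
      (K ∩ {z | D.shifted T σ z x x ≠ 0}) :=
    (hB.mono fun z hz => hKU hz.1).clm_apply contDiffOn_const
  obtain ⟨φ, hφ, hφ0, h⟩ := exists_integral_hypersurface L hΩ hα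
    (fun z hz => by rw [hL]; exact hz.2) (fun z hz v w hv hw => by
      have hzU := hKU hz.1
      have hd := ((hB.contDiffAt (D.hU.mem_nhds hzU)).differentiableAt (by simp)).hasFDerivAt
      have h1 : ∀ v w, fderiv ℝ (fun z => D.shifted T σ z x) z v w =
          fderiv ℝ (D.shifted T σ) z v x w := fun v w => by
        rw [(hd.clm_apply (hasFDerivAt_const x z)).fderiv]
        simp
      have h3 := codazzi_shifted hT hσ hzU (hdσ z hz.1) v w x
      rw [(shifted_eq_zero_iff hT h2 hzU hz.2).2 hv,
        (shifted_eq_zero_iff hT h2 hzU hz.2).2 hw] at h3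
      rw [h1, h1, fderiv_shifted_symm hT hσ hzU v, fderiv_shifted_symm hT hσ hzU w]
      simpa using h3) ⟨hq, hx⟩
  have hsub : Set.range φ ⊆ K := by
    rintro _ ⟨y, rfl⟩
    exact (h y).1.1
  refine ⟨Set.range φ, ⟨0, hφ0⟩, hsub, hsub.trans hKU, fun r hr =>
    ⟨φ, K, hK, hsub hr, hKU, hφ, fun y hy => (h y).2.trans (Set.ext fun v => ?_), rfl⟩⟩
  exact ((mem_eigenSet_iff hT hy).trans (shifted_eq_zero_iff hT h2 hy (h y).1.2)).symm

end RiemannChart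

/-- If a Codazzi tensor `T` on `(Mⁿ,g)`, `n ≥ 3`, has at every point
exactly two distinct eigenvalues `ρ` and `σ` of multiplicities `1` and `n-1`, and
`W = {p | dσ(p) ≠ 0}`, then on each connected component of the complement of
`W̄ = W ∪ ∂W`, the eigenvalue `σ` is constant and the component is foliated by totally
geodesic hypersurfaces tangent to the `σ`-eigendistribution of `T`. -/
theorem codazzi_two_eigenvalues_complement_foliated
    {n : ℕ} (hn : 3 ≤ n) (D : RiemannChart n)
    (T : E n → E n → E n → ℝ) (ρ σ : E n → ℝ)
    (hT : D.IsCodazzi T) (h2 : D.HasTwoEigenvalues T ρ σ)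
    (hρ : ContDiffOn ℝ (⊤ : ℕ∞) ρ D.U) (hσ : ContDiffOn ℝ (⊤ : ℕ∞) σ D.U) :
    ∀ p ∈ D.U \ closure {q ∈ D.U | fderiv ℝ σ q ≠ 0},
      ∀ K : Set (E n),
        K = connectedComponentIn (D.U \ closure {q ∈ D.U | fderiv ℝ σ q ≠ 0}) p →
        (∀ q ∈ K, ∀ q' ∈ K, σ q = σ q') ∧
        (∀ q ∈ K, ∃ S : Set (E n), q ∈ S ∧ S ⊆ K ∧
          D.IsIntegralHypersurface (fun r => D.eigenSet T r (σ r)) S ∧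
          (∀ r ∈ S, D.TotallyGeodesicAt (fun r' => D.eigenSet T r' (σ r')) r)) := by
  rintro p - K rfl
  set Ω := D.U \ closure {q ∈ D.U | fderiv ℝ σ q ≠ 0} with hΩdef
  have hΩ : IsOpen Ω := D.hU.sdiff isClosed_closure
  have hdσ : ∀ z ∈ Ω, fderiv ℝ σ z = 0 := fun z hz => by
    by_contra h
    exact hz.2 (subset_closure ⟨hz.1, h⟩)
  have hK : IsOpen (connectedComponentIn Ω p) := hΩ.connectedComponentIn
  have hKΩ : connectedComponentIn Ω p ⊆ Ω := connectedComponentIn_subset Ω p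
  refine ⟨fun q hq q' hq' => ?_, fun q hq => ?_⟩
  · exact hK.is_const_of_fderiv_eq_zero isPreconnected_connectedComponentIn
      ((hσ.differentiableOn (by simp)).mono fun z hz => (hKΩ hz).1)
      (fun z hz => hdσ z (hKΩ hz)) hq hq'
  · obtain ⟨S, hqS, hSK, hS⟩ := D.exists_isIntegralHypersurface hT h2 hσ (by omega) hK
      (fun z hz => (hKΩ hz).1) (fun z hz => hdσ z (hKΩ hz)) hq
    exact ⟨S, hqS, hSK, hS, fun r hr =>
      RiemannChart.totallyGeodesicAt_eigenSet hT h2 hσ (hKΩ (hSK hr)).1 (hdσ r (hKΩ (hSK hr)))⟩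

end
end

section
/- Let (M^n, g) be a smooth Riemannian manifold with n ≥ 3 and let T be a Codazzi tensor on M which at every point has exactly two distinct eigenvalues ρ and σ, of multiplicity 1 and n−1 respectively, with eigendistributions V_ρ (a line field) and V_σ (a codimension one distribution with totally umbilical integral leaves). Then for every vector X belonging to V_σ and unit vector ν spanning V_ρ, the Ricci tensor of g satisfies Ric(X, ν) = 0. -/
noncomputable section

open scoped RealInnerProductSpace

theorem Matrix.trace_mul_eq_zero_of_isSymm_of_transpose_eq_neg {ι : Type*} [Fintype ι]
    {P K : Matrix ι ι ℝ} (hP : P.IsSymm) (hK : K.transpose = -K) : (P * K).trace = 0 := by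
  have h : (P * K).trace = -(P * K).trace := by
    conv_lhs => rw [← Matrix.trace_transpose, Matrix.transpose_mul, hK, hP.eq,
      Matrix.trace_mul_comm, Matrix.mul_neg, Matrix.trace_neg]
  linarith

/-- On `U`, `B` is a smooth field of symmetric bilinear forms. -/
structure SmoothSymmForm {n : ℕ} (U : Set (E n)) (B : E n → E n → E n → ℝ) : Prop where
  symm : ∀ p ∈ U, ∀ v w, B p v w = B p w v
  lin : ∀ p ∈ U, ∀ (a : ℝ) u v w, B p (a • u + v) w = a * B p u w + B p v w
  smooth : ∀ v w, ContDiffOn ℝ (⊤ : ℕ∞) (fun q => B q v w) U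

namespace SmoothSymmForm

variable {n : ℕ} {U : Set (E n)} {B : E n → E n → E n → ℝ} {p : E n}

theorem add_left (h : SmoothSymmForm U B) (hp : p ∈ U) (u v w : E n) :
    B p (u + v) w = B p u w + B p v w := by
  simpa using h.lin p hp 1 u v w

theorem zero_left (h : SmoothSymmForm U B) (hp : p ∈ U) (w : E n) : B p 0 w = 0 := by
  simpa using h.add_left hp 0 0 w

theorem smul_left (h : SmoothSymmForm U B) (hp : p ∈ U) (a : ℝ) (u w : E n) :
    B p (a • u) w = a * B p u w := by
  simpa [h.zero_left hp] using h.lin p hp a u 0 w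

theorem neg_left (h : SmoothSymmForm U B) (hp : p ∈ U) (u w : E n) :
    B p (-u) w = -B p u w := by
  simpa using h.smul_left hp (-1) u w

theorem sub_left (h : SmoothSymmForm U B) (hp : p ∈ U) (u v w : E n) :
    B p (u - v) w = B p u w - B p v w := by
  rw [sub_eq_add_neg, h.add_left hp, h.neg_left hp, sub_eq_add_neg]

theorem sum_left (h : SmoothSymmForm U B) (hp : p ∈ U) {ι : Type*} (s : Finset ι)
    (f : ι → E n) (w : E n) : B p (∑ i ∈ s, f i) w = ∑ i ∈ s, B p (f i) w := by
  classical
  induction s using Finset.induction_on with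
  | empty => simpa using h.zero_left hp w
  | insert i s hi ih => rw [Finset.sum_insert hi, Finset.sum_insert hi, h.add_left hp, ih]

theorem eq_sum_left (h : SmoothSymmForm U B) (hp : p ∈ U) (v w : E n) :
    B p v w = ∑ i, v i * B p (e n i) w := by
  conv_lhs => rw [show v = ∑ i, v i • e n i by ext j; simp [e, Finset.sum_apply, Pi.single_apply]]
  rw [h.sum_left hp]
  exact Finset.sum_congr rfl fun i _ => h.smul_left hp _ _ _

theorem contDiffAt_two (h : SmoothSymmForm U B) (hU : IsOpen U) (hp : p ∈ U) (v w : E n) :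
    ContDiffAt ℝ 2 (fun q => B q v w) p :=
  ((h.smooth v w).contDiffAt (hU.mem_nhds hp)).of_le (WithTop.coe_le_coe.2 le_top)

theorem differentiableAt (h : SmoothSymmForm U B) (hU : IsOpen U) (hp : p ∈ U) (v w : E n) :
    DifferentiableAt ℝ (fun q => B q v w) p :=
  (h.contDiffAt_two hU hp v w).differentiableAt (by simp)

theorem hasFDerivAt_comp (h : SmoothSymmForm U B) (hU : IsOpen U) (hp : p ∈ U)
    {V : E n → E n} (hV : DifferentiableAt ℝ V p) (w : E n) :
    HasFDerivAt (fun q => B q (V q) w)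
      (∑ i, (V p i • fderiv ℝ (fun q => B q (e n i) w) p
        + B p (e n i) w • (EuclideanSpace.proj i : E n →L[ℝ] ℝ).comp (fderiv ℝ V p))) p := by
  have hsum : HasFDerivAt (fun q => ∑ i, V q i * B q (e n i) w)
      (∑ i, (V p i • fderiv ℝ (fun q => B q (e n i) w) p
        + B p (e n i) w • (EuclideanSpace.proj i : E n →L[ℝ] ℝ).comp (fderiv ℝ V p))) p := by
    refine HasFDerivAt.fun_sum fun i _ => ?_
    exact HasFDerivAt.mul
      ((EuclideanSpace.proj i : E n →L[ℝ] ℝ).hasFDerivAt.comp p hV.hasFDerivAt)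
      (h.differentiableAt hU hp (e n i) w).hasFDerivAt
  refine hsum.congr_of_eventuallyEq ?_
  filter_upwards [hU.mem_nhds hp] with q hq using h.eq_sum_left hq (V q) w

theorem fderiv_comp (h : SmoothSymmForm U B) (hU : IsOpen U) (hp : p ∈ U)
    {V : E n → E n} (hV : DifferentiableAt ℝ V p) (w x : E n) :
    fderiv ℝ (fun q => B q (V q) w) p x
      = fderiv ℝ (fun q => B q (V p) w) p x + B p (fderiv ℝ V p x) w := by
  have hconst := h.hasFDerivAt_comp hU hp (differentiableAt_const (V p)) w
  rw [(h.hasFDerivAt_comp hU hp hV w).fderiv, hconst.fderiv, h.eq_sum_left hp (fderiv ℝ V p x) w]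
  simp [Finset.sum_add_distrib, mul_comm]

theorem fderiv_comp_right (h : SmoothSymmForm U B) (hU : IsOpen U) (hp : p ∈ U)
    {V : E n → E n} (hV : DifferentiableAt ℝ V p) (w x : E n) :
    fderiv ℝ (fun q => B q w (V q)) p x
      = fderiv ℝ (fun q => B q w (V p)) p x + B p w (fderiv ℝ V p x) := by
  have hswap : ∀ W : E n → E n,
      (fun q => B q w (W q)) =ᶠ[nhds p] fun q => B q (W q) w := fun W => by
    filter_upwards [hU.mem_nhds hp] with q hq using h.symm q hq w (W q)
  rw [(hswap V).fderiv_eq, (hswap fun _ => V p).fderiv_eq, h.symm p hp w,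
    h.fderiv_comp hU hp hV]

end SmoothSymmForm

namespace RiemannChart

variable {n : ℕ} (D : RiemannChart n) {T : E n → E n → E n → ℝ} {p : E n}

theorem smoothSymmForm_g : SmoothSymmForm D.U D.g :=
  ⟨fun p _ => D.g_symm p, fun p _ => D.g_lin p, D.g_smooth⟩

variable {D} in
theorem IsCodazzi.smoothSymmForm (hT : D.IsCodazzi T) : SmoothSymmForm D.U T :=
  ⟨hT.1, hT.2.1, hT.2.2.1⟩

theorem differentiableAt_Γ (hp : p ∈ D.U) (v w : E n) :
    DifferentiableAt ℝ (fun q => D.Γ q v w) p :=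
  ((D.Γ_smooth v w).contDiffAt (D.hU.mem_nhds hp)).differentiableAt (by simp)

/-- The second covariant derivative `(∇²_{x,y} T)(z,u)` of a `(0,2)`-tensor field. -/
def secondCovDeriv2 (T : E n → E n → E n → ℝ) (p x y z u : E n) : ℝ :=
  fderiv ℝ (fun q => D.covDeriv2 T q y z u) p x - D.covDeriv2 T p (D.Γ p x y) z u
    - D.covDeriv2 T p y (D.Γ p x z) u - D.covDeriv2 T p y z (D.Γ p x u)

theorem fderiv_covDeriv2 (hT : SmoothSymmForm D.U T) (hp : p ∈ D.U) (x y z u : E n) :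
    fderiv ℝ (fun q => D.covDeriv2 T q y z u) p x
      = fderiv ℝ (fderiv ℝ fun q => T q z u) p x y
        - (fderiv ℝ (fun q => T q (D.Γ p y z) u) p x
          + T p (fderiv ℝ (fun q => D.Γ q y z) p x) u)
        - (fderiv ℝ (fun q => T q z (D.Γ p y u)) p x
          + T p z (fderiv ℝ (fun q => D.Γ q y u) p x)) := by
  have hd : DifferentiableAt ℝ (fderiv ℝ fun q => T q z u) p :=
    ((hT.contDiffAt_two D.hU hp z u).fderiv_right (m := 1)
      one_add_one_eq_two.le).differentiableAt (by simp)
  have hl : DifferentiableAt ℝ (fun q => T q (D.Γ q y z) u) p :=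
    (hT.hasFDerivAt_comp D.hU hp (D.differentiableAt_Γ hp y z) u).differentiableAt
  have hr : DifferentiableAt ℝ (fun q => T q z (D.Γ q y u)) p := by
    refine (hT.hasFDerivAt_comp D.hU hp (D.differentiableAt_Γ hp y u) z).differentiableAt
      |>.congr_of_eventuallyEq ?_
    filter_upwards [D.hU.mem_nhds hp] with q hq using hT.symm q hq _ _
  have hy : DifferentiableAt ℝ (fun q => fderiv ℝ (fun q => T q z u) q y) p :=
    hd.clm_apply (differentiableAt_const y)
  rw [← hT.fderiv_comp D.hU hp (D.differentiableAt_Γ hp y z),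
    ← hT.fderiv_comp_right D.hU hp (D.differentiableAt_Γ hp y u)]
  unfold covDeriv2
  rw [fderiv_fun_sub (hy.fun_sub hl) hr, fderiv_fun_sub hy hl,
    fderiv_clm_apply hd (differentiableAt_const y)]
  simp

/-- The Ricci identity for a symmetric `(0,2)`-tensor field. -/
theorem secondCovDeriv2_sub_swap (hT : SmoothSymmForm D.U T) (hp : p ∈ D.U) (x y z u : E n) :
    D.secondCovDeriv2 T p x y z u - D.secondCovDeriv2 T p y x z u
      = -T p (D.Riem p x y z) u - T p z (D.Riem p x y u) := by
  have hsymm : fderiv ℝ (fderiv ℝ fun q => T q z u) p x y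
      = fderiv ℝ (fderiv ℝ fun q => T q z u) p y x :=
    ((hT.contDiffAt_two D.hU hp z u).isSymmSndFDerivAt (by simp)) x y
  rw [hT.symm p hp z (D.Riem p x y u)]
  simp only [secondCovDeriv2, D.fderiv_covDeriv2 hT hp, D.Γ_symm p y x, Riem, hT.add_left hp,
    hT.sub_left hp, hsymm, hT.symm p hp z]
  simp only [covDeriv2, hT.symm p hp z]
  ring

theorem secondCovDeriv2_g (hp : p ∈ D.U) (x y z u : E n) :
    D.secondCovDeriv2 D.g p x y z u = 0 := by
  have hzero : ∀ q ∈ D.U, ∀ y z u, D.covDeriv2 D.g q y z u = 0 := fun q hq y z u => by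
    rw [covDeriv2, D.compat q hq]; ring
  have hloc : (fun q => D.covDeriv2 D.g q y z u) =ᶠ[nhds p] fun _ => 0 := by
    filter_upwards [D.hU.mem_nhds hp] with q hq using hzero q hq y z u
  simp [secondCovDeriv2, hloc.fderiv_eq, hzero p hp]

theorem Riem_swap (x y z : E n) : D.Riem p x y z = -D.Riem p y x z := by
  simp only [Riem]; abel

/-- The first Bianchi identity. -/
theorem Riem_bianchi (x y z : E n) :
    D.Riem p x y z + D.Riem p y z x + D.Riem p z x y = 0 := by
  have hsymm : ∀ v w, (fun q => D.Γ q v w) = fun q => D.Γ q w v := fun v w =>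
    funext fun q => D.Γ_symm q v w
  simp only [Riem, hsymm y x, hsymm z x, hsymm z y, D.Γ_symm p y x, D.Γ_symm p z x,
    D.Γ_symm p z y]
  abel

theorem g_Riem_skew (hp : p ∈ D.U) (x y z u : E n) :
    D.g p (D.Riem p x y z) u = -D.g p (D.Riem p x y u) z := by
  have h := D.secondCovDeriv2_sub_swap D.smoothSymmForm_g hp x y z u
  rw [D.secondCovDeriv2_g hp, D.secondCovDeriv2_g hp, D.g_symm p z] at h
  linarith

theorem g_Riem_pair_symm (hp : p ∈ D.U) (x y z u : E n) :
    D.g p (D.Riem p x y z) u = D.g p (D.Riem p z u x) y := by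
  have hg := D.smoothSymmForm_g
  have bianchi : ∀ a b c d, D.g p (D.Riem p a b c) d + D.g p (D.Riem p b c a) d
      + D.g p (D.Riem p c a b) d = 0 := fun a b c d => by
    rw [← hg.add_left hp, ← hg.add_left hp, D.Riem_bianchi, hg.zero_left hp]
  have swap : ∀ a b c d, D.g p (D.Riem p a b c) d = -D.g p (D.Riem p b a c) d :=
    fun a b c d => by rw [D.Riem_swap, hg.neg_left hp]
  have skew := D.g_Riem_skew hp
  linarith [bianchi x y z u, bianchi y z u x, bianchi z u x y, bianchi u x y z,
    swap x y z u, swap y z u x, swap z u x y, swap u x y z, swap x z y u, swap y u z x,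
    swap z x y u, swap u y z x, skew x y z u, skew y z x u, skew z x y u, skew z u y x,
    skew z u x y, skew u y z x, skew u x z y, skew u x y z, skew x z u y, skew y u x z,
    skew y z u x]

/-- The algebraic consequence of the Codazzi equation and the Ricci identity. -/
theorem IsCodazzi.cyclic_Riem (hT : D.IsCodazzi T) (hp : p ∈ D.U) (x y z u : E n) :
    T p z (D.Riem p x y u) + T p x (D.Riem p y z u) + T p y (D.Riem p z x u) = 0 := by
  have hB := hT.smoothSymmForm
  have hswap : ∀ a b c, D.secondCovDeriv2 T p a b c u = D.secondCovDeriv2 T p a c b u :=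
    fun a b c => by
      have hC := hT.2.2.2
      have hloc : (fun q => D.covDeriv2 T q b c u) =ᶠ[nhds p] fun q => D.covDeriv2 T q c b u := by
        filter_upwards [D.hU.mem_nhds hp] with q hq using hC q hq b c u
      simp only [secondCovDeriv2]
      rw [hloc.fderiv_eq, hC p hp (D.Γ p a b) c u, hC p hp b (D.Γ p a c) u, hC p hp b c]
      ring
  have hbianchi : T p (D.Riem p x y z) u + T p (D.Riem p y z x) u
      + T p (D.Riem p z x y) u = 0 := by
    rw [← hB.add_left hp, ← hB.add_left hp, D.Riem_bianchi, hB.zero_left hp]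
  linarith [D.secondCovDeriv2_sub_swap hB hp x y z u, D.secondCovDeriv2_sub_swap hB hp y z x u,
    D.secondCovDeriv2_sub_swap hB hp z x y u, hswap x y z, hswap y z x, hswap z x y]

open Matrix in
/-- A Codazzi tensor commutes with the Ricci tensor, tested on a pair of eigenvectors. -/
theorem IsCodazzi.mul_Ric_eq_mul_Ric (hT : D.IsCodazzi T) (hp : p ∈ D.U) {a b : ℝ} {v w : E n}
    (hv : v ∈ D.eigenSet T p a) (hw : w ∈ D.eigenSet T p b) :
    a * D.Ric p v w = b * D.Ric p v w := by
  have hB := hT.smoothSymmForm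
  have hg := D.smoothSymmForm_g
  let N : Matrix (Fin n) (Fin n) ℝ := of fun i j => D.ginv p (e n i) (e n j)
  let G : Matrix (Fin n) (Fin n) ℝ := of fun i j => D.g p (e n i) (e n j)
  let A : Matrix (Fin n) (Fin n) ℝ := of fun i j => T p (e n i) (e n j)
  let R : Matrix (Fin n) (Fin n) ℝ := of fun i j => D.Riem p v w (e n j) i
  let C : Matrix (Fin n) (Fin n) ℝ := of fun i j => D.Riem p (e n j) v w i
  let C' : Matrix (Fin n) (Fin n) ℝ := of fun i j => D.Riem p (e n j) w v i
  have hNG : N * G = 1 := by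
    ext i j
    simpa [N, G, mul_apply, one_apply] using D.ginv_g p hp i j
  have hN : N.IsSymm := IsSymm.ext fun i j => D.ginv_symm p _ _
  have hA : A.IsSymm := IsSymm.ext fun i j => hB.symm p hp _ _
  have mul_col {S : E n → E n → E n → ℝ} (hS : SmoothSymmForm D.U S) (x y : E n) :
      ∑ k, S p x (e n k) * y k = S p x y := by
    rw [hS.symm p hp x y, hS.eq_sum_left hp]
    exact Finset.sum_congr rfl fun k _ => by rw [hS.symm p hp x, mul_comm]
  have hK : (G * R)ᵀ = -(G * R) := by
    ext i j
    simp only [transpose_apply, Matrix.neg_apply, mul_apply, G, R, of_apply, mul_col hg]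
    rw [D.g_symm, D.g_Riem_skew hp, D.g_symm p (e n i)]
  have hR : R = N * (G * R) := by rw [← Matrix.mul_assoc, hNG, Matrix.one_mul]
  have htrR : R.trace = 0 := by
    rw [hR]
    exact trace_mul_eq_zero_of_isSymm_of_transpose_eq_neg hN hK
  have htrAR : (N * A * R).trace = 0 := by
    rw [hR, ← Matrix.mul_assoc]
    refine trace_mul_eq_zero_of_isSymm_of_transpose_eq_neg ?_ hK
    simp only [IsSymm, transpose_mul, hN.eq, hA.eq, Matrix.mul_assoc]
  have hcyc : A * R + a • (G * C) - b • (G * C') = 0 := by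
    ext i j
    simp only [Matrix.sub_apply, Matrix.add_apply, Matrix.smul_apply, Matrix.zero_apply,
      mul_apply, A, G, R, C, C', of_apply, mul_col hg, mul_col hB, smul_eq_mul]
    have h := hT.cyclic_Riem D hp v w (e n i) (e n j)
    rw [hv, hw, D.g_symm p v, D.g_Riem_pair_symm hp w, D.g_symm p w,
      D.g_Riem_pair_symm hp (e n i), D.g_Riem_skew hp (e n j) w] at h
    rw [D.g_symm p (e n i), D.g_symm p (e n i)]
    linarith
  have hbianchi : C - C' = -R := by
    ext i j
    have h := congrArg (fun x : E n => x i) (D.Riem_bianchi (p := p) v w (e n j))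
    rw [D.Riem_swap w (e n j)] at h
    simp only [PiLp.add_apply, PiLp.neg_apply, PiLp.zero_apply] at h
    simp only [Matrix.sub_apply, Matrix.neg_apply, C, C', R, of_apply]
    linarith
  have htrC : C.trace = C'.trace := by
    have h := congrArg trace hbianchi
    rw [trace_sub, trace_neg, htrR] at h
    linarith
  have htr : a * C.trace - b * C'.trace = 0 := by
    have h := congrArg (fun M => (N * M).trace) hcyc
    simpa [Matrix.mul_add, Matrix.mul_sub, ← Matrix.mul_assoc, hNG, htrAR] using h
  rw [← htrC] at htr
  exact sub_eq_zero.1 htr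

end RiemannChart

/-- If a Codazzi tensor `T` on `(Mⁿ,g)`, `n ≥ 3`, has at every point
exactly two distinct eigenvalues `ρ` and `σ` of multiplicities `1` and `n-1` (so that
the eigendistribution `V_ρ` is a line field and `V_σ` has codimension one), then for
every `X ∈ V_σ` and every unit `ν` spanning `V_ρ` one has `Ric(X, ν) = 0`. -/
theorem codazzi_two_eigenvalues_ricci_mixed_zero
    {n : ℕ} (hn : 3 ≤ n) (D : RiemannChart n)
    (T : E n → E n → E n → ℝ) (ρ σ : E n → ℝ)
    (hT : D.IsCodazzi T) (h2 : D.HasTwoEigenvalues T ρ σ) :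
    ∀ p ∈ D.U, ∀ v ∈ D.eigenSet T p (σ p), ∀ w ∈ D.eigenSet T p (ρ p),
      D.g p w w = 1 → D.Ric p v w = 0 := by
  intro p hp v hv w hw _
  by_contra hne
  exact h2.1 p hp (mul_right_cancel₀ hne (hT.mul_Ric_eq_mul_Ric D hp hv hw)).symm

end
end

section
/- Let (M^n, g) be a smooth Riemannian manifold with n ≥ 3 and let T be a Codazzi tensor on M which at every point has exactly two distinct eigenvalues ρ and σ, of multiplicity 1 and n−1 respectively, and let V_σ denote the (n−1)-dimensional eigendistribution of T relative to σ. Then the mean curvature H of each integral leaf of V_σ is constant along every connected component of the leaf. -/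
noncomputable section

open scoped RealInnerProductSpace

namespace RiemannChart

section LinearFields

variable {n : ℕ} {U : Set (E n)} {G : E n → E n → ℝ} {Y : E n → E n}

theorem apply_eq_sum_coord {L : E n → ℝ}
    (hL : ∀ (a : ℝ) u v, L (a • u + v) = a * L u + L v) (y : E n) :
    L y = ∑ i, y i * L (e n i) := by
  have h0 : L 0 = 0 := by simpa using hL 1 0 0
  let L' : E n →ₗ[ℝ] ℝ :=
    { toFun := L
      map_add' := fun u v => by simpa using hL 1 u v
      map_smul' := fun a u => by simpa [h0] using hL a u 0 }
  have hy : y = ∑ i, y i • e n i := by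
    simpa [e] using ((EuclideanSpace.basisFun (Fin n) ℝ).sum_repr y).symm
  change L' y = ∑ i, y i * L' (e n i)
  conv_lhs => rw [hy]
  simp

theorem contDiffOn_apply_field
    (hG : ∀ q ∈ U, ∀ (a : ℝ) u v, G q (a • u + v) = a * G q u + G q v)
    (hGs : ∀ v, ContDiffOn ℝ (⊤ : ℕ∞) (fun q => G q v) U)
    (hY : ContDiffOn ℝ (⊤ : ℕ∞) Y U) :
    ContDiffOn ℝ (⊤ : ℕ∞) (fun q => G q (Y q)) U := by
  have h : ContDiffOn ℝ (⊤ : ℕ∞) (fun q => ∑ i, Y q i * G q (e n i)) U :=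
    ContDiffOn.sum fun i _ => ((contDiffOn_euclidean.mp hY) i).mul (hGs _)
  exact h.congr fun q hq => apply_eq_sum_coord (hG q hq) _

theorem fderiv_apply_field (hU : IsOpen U)
    (hG : ∀ q ∈ U, ∀ (a : ℝ) u v, G q (a • u + v) = a * G q u + G q v)
    (hGs : ∀ v, ContDiffOn ℝ (⊤ : ℕ∞) (fun q => G q v) U)
    (hY : ContDiffOn ℝ (⊤ : ℕ∞) Y U) {p : E n} (hp : p ∈ U) (v : E n) :
    fderiv ℝ (fun q => G q (Y q)) p v
      = fderiv ℝ (fun q => G q (Y p)) p v + G p (fderiv ℝ Y p v) := by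
  have hUp : U ∈ nhds p := hU.mem_nhds hp
  have hdG : ∀ w, DifferentiableAt ℝ (fun q => G q w) p := fun w =>
    ((hGs w).contDiffAt hUp).differentiableAt (by simp)
  have hdY : DifferentiableAt ℝ Y p := (hY.contDiffAt hUp).differentiableAt (by simp)
  have hYi : ∀ i, HasFDerivAt (fun q => Y q i)
      ((EuclideanSpace.proj i : E n →L[ℝ] ℝ).comp (fderiv ℝ Y p)) p := fun i =>
    (EuclideanSpace.proj i : E n →L[ℝ] ℝ).hasFDerivAt.comp p hdY.hasFDerivAt
  have e1 : (fun q => G q (Y q)) =ᶠ[nhds p] fun q => ∑ i, Y q i * G q (e n i) := by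
    filter_upwards [hUp] with q hq using apply_eq_sum_coord (hG q hq) _
  have e2 : (fun q => G q (Y p)) =ᶠ[nhds p] fun q => ∑ i, Y p i * G q (e n i) := by
    filter_upwards [hUp] with q hq using apply_eq_sum_coord (hG q hq) _
  have d1 := HasFDerivAt.fun_sum (u := Finset.univ)
    fun i _ => (hYi i).fun_mul (hdG (e n i)).hasFDerivAt
  have d2 := HasFDerivAt.fun_sum (u := Finset.univ)
    fun i _ => (hdG (e n i)).hasFDerivAt.const_mul (Y p i)
  rw [e1.fderiv_eq, e2.fderiv_eq, d1.fderiv, d2.fderiv,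
    apply_eq_sum_coord (hG p hp) (fderiv ℝ Y p v)]
  simp [Finset.sum_add_distrib, mul_comm]

end LinearFields

section Metric

variable {n : ℕ} (D : RiemannChart n)

theorem g_lin_right (p : E n) (a : ℝ) (u v w : E n) :
    D.g p w (a • u + v) = a * D.g p w u + D.g p w v := by
  rw [D.g_symm, D.g_lin, D.g_symm p u, D.g_symm p v]

/-- The one-form `g(x, ·)` metrically dual to a vector `x`. -/
def flat (p x : E n) : E n →ₗ[ℝ] ℝ where
  toFun := D.g p x
  map_add' u v := by simpa using D.g_lin_right p 1 u v x
  map_smul' a u := by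
    have h0 : D.g p x 0 = 0 := by simpa using D.g_lin_right p 1 0 0 x
    simpa [h0] using D.g_lin_right p a u 0 x

theorem flat_apply (p x w : E n) : D.flat p x w = D.g p x w := rfl

theorem g_add_right (p u v w : E n) : D.g p w (u + v) = D.g p w u + D.g p w v :=
  (D.flat p w).map_add u v

theorem g_add_left (p u v w : E n) : D.g p (u + v) w = D.g p u w + D.g p v w := by
  rw [D.g_symm, D.g_add_right, D.g_symm p w, D.g_symm p w]

variable {T : E n → E n → E n → ℝ} {ν : E n → E n} {p : E n}

theorem contDiffOn_g_field (hν : ContDiffOn ℝ (⊤ : ℕ∞) ν D.U) (w : E n) :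
    ContDiffOn ℝ (⊤ : ℕ∞) (fun q => D.g q (ν q) w) D.U :=
  contDiffOn_apply_field (G := fun q u => D.g q u w)
    (fun q _ a u v => D.g_lin q a u v w) (fun v => D.g_smooth v w) hν

theorem fderiv_g_field (hν : ContDiffOn ℝ (⊤ : ℕ∞) ν D.U) (hp : p ∈ D.U) (v w : E n) :
    fderiv ℝ (fun q => D.g q (ν q) w) p v
      = D.g p (D.covDeriv ν p v) w + D.g p (ν p) (D.Γ p v w) := by
  rw [fderiv_apply_field (G := fun q u => D.g q u w) D.hU
    (fun q _ a u v => D.g_lin q a u v w) (fun v => D.g_smooth v w) hν hp v,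
    D.compat p hp, covDeriv, D.g_add_left]
  ring

theorem g_covDeriv_self_eq_zero (hν : ContDiffOn ℝ (⊤ : ℕ∞) ν D.U)
    (hunit : ∀ q ∈ D.U, D.g q (ν q) (ν q) = 1) (hp : p ∈ D.U) (v : E n) :
    D.g p (D.covDeriv ν p v) (ν p) = 0 := by
  have h1 := fderiv_apply_field (G := fun q u => D.g q (ν q) u) D.hU
    (fun q _ a u v => D.g_lin_right q a u v (ν q)) (fun w => D.contDiffOn_g_field hν w) hν hp v
  have h2 : (fun q => D.g q (ν q) (ν q)) =ᶠ[nhds p] fun _ => (1 : ℝ) := by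
    filter_upwards [D.hU.mem_nhds hp] with q hq using hunit q hq
  rw [h2.fderiv_eq, D.fderiv_g_field hν hp] at h1
  simp only [fderiv_fun_const, Pi.zero_apply, zero_apply] at h1
  have h3 : D.g p (ν p) (D.covDeriv ν p v)
      = D.g p (ν p) (fderiv ℝ ν p v) + D.g p (ν p) (D.Γ p v (ν p)) := by
    rw [covDeriv, D.g_add_right]
  rw [D.g_symm] at h3
  linarith

theorem mem_eigenSet_iff_of_eigenMult {lam mu : ℝ} {x : E n}
    (hTs : ∀ v w, T p v w = T p w v)
    (hTl : ∀ (a : ℝ) u v w, T p (a • u + v) w = a * T p u w + T p v w)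
    (hne : mu ≠ lam) (hmult : D.eigenMult T p lam = n - 1)
    (hx : x ∈ D.eigenSet T p mu) (hx1 : D.g p x x = 1) (w : E n) :
    w ∈ D.eigenSet T p lam ↔ D.g p x w = 0 := by
  have hsub : D.eigenSet T p lam ⊆ LinearMap.ker (D.flat p x) := by
    intro v hv
    have h1 := hx v
    have h2 := hv x
    rw [hTs, h1, D.g_symm p v x] at h2
    have h3 : (mu - lam) * D.g p x v = 0 := by linarith
    exact (mul_eq_zero.mp h3).resolve_left (sub_ne_zero.mpr hne)
  have h0T : ∀ w, T p 0 w = 0 := fun w => by simpa using hTl 1 0 0 w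
  have h0g : ∀ w, D.g p 0 w = 0 := fun w => by simpa using D.g_lin p 1 0 0 w
  let S : Submodule ℝ (E n) :=
    { carrier := D.eigenSet T p lam
      zero_mem' := fun w => by rw [h0T, h0g, mul_zero]
      add_mem' := fun {u v} hu hv w => by
        have h := hTl 1 u v w
        rw [one_smul, hu w, hv w] at h
        rw [h, D.g_add_left]
        ring
      smul_mem' := fun a u hu w => by
        have h := hTl a u 0 w
        have h' := D.g_lin p a u 0 w
        rw [add_zero] at h h'
        rw [h, h', hu w, h0T, h0g]
        ring }
  have hspan : Submodule.span ℝ (D.eigenSet T p lam) = S := Submodule.span_eq S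
  have hSle : S ≤ LinearMap.ker (D.flat p x) := hsub
  have hrank : Module.finrank ℝ (LinearMap.ker (D.flat p x)) = n - 1 := by
    have hsurj : LinearMap.range (D.flat p x) = ⊤ :=
      LinearMap.range_eq_top.mpr fun r => ⟨r • x, by
        rw [map_smul, D.flat_apply, hx1, smul_eq_mul, mul_one]⟩
    have h := LinearMap.finrank_range_add_finrank_ker (D.flat p x)
    rw [hsurj] at h
    simp only [finrank_top, Module.finrank_self, finrank_euclideanSpace, Fintype.card_fin] at h
    omega
  have hS : S = LinearMap.ker (D.flat p x) :=
    Submodule.eq_of_le_of_finrank_eq hSle (by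
      rw [hrank, ← hspan]
      exact hmult)
  change w ∈ S ↔ _
  rw [hS, LinearMap.mem_ker, flat_apply]

theorem sub_smul_orthogonal {x : E n} (hx1 : D.g p x x = 1) (w : E n) :
    D.g p x (w - D.g p x w • x) = 0 := by
  have h : D.flat p x (w - D.flat p x w • x) = 0 := by
    rw [map_sub, map_smul, D.flat_apply p x x, hx1, smul_eq_mul, mul_one, sub_self]
  exact h

theorem exists_ne_zero_orthogonal (hn : 3 ≤ n) (x y : E n) :
    ∃ z, z ≠ 0 ∧ D.g p x z = 0 ∧ D.g p y z = 0 := by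
  have hker : LinearMap.ker ((D.flat p x).prod (D.flat p y)) ≠ ⊥ := by
    apply LinearMap.ker_ne_bot_of_finrank_lt
    simp
    omega
  obtain ⟨z, hz, hz0⟩ := Submodule.exists_mem_ne_zero_of_ne_bot hker
  have hz' : (D.flat p x z, D.flat p y z) = (0, 0) := hz
  exact ⟨z, hz0, congrArg Prod.fst hz', congrArg Prod.snd hz'⟩

theorem eq_smul_g_add_smul_flat {lam mu : ℝ} {x : E n}
    (hTl : ∀ (a : ℝ) u v w, T p (a • u + v) w = a * T p u w + T p v w)
    (hx : x ∈ D.eigenSet T p mu) (hx1 : D.g p x x = 1)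
    (hker : ∀ w, D.g p x w = 0 → w ∈ D.eigenSet T p lam) (w u : E n) :
    T p w u = lam * D.g p w u + (mu - lam) * (D.g p x w * D.g p x u) := by
  have hw : w = D.g p x w • x + (w - D.g p x w • x) := by abel
  have h1 := hTl (D.g p x w) x (w - D.g p x w • x) u
  have h2 := D.g_lin p (D.g p x w) x (w - D.g p x w • x) u
  rw [← hw] at h1 h2
  rw [h1, hx u, hker _ (D.sub_smul_orthogonal hx1 w) u]
  linear_combination -lam * h2

end Metric

section SpectralForm

variable {n : ℕ} (D : RiemannChart n) {T : E n → E n → E n → ℝ} {ν : E n → E n}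
  {σ φ : E n → ℝ} {p : E n}

/-- The coefficient `σ` in `T = σ g + φ ν♭ ⊗ ν♭` is smooth as soon as `σ + φ` is. -/
theorem contDiffAt_of_eq_smul_g_add (hn : 3 ≤ n)
    (hTsm : ∀ v w, ContDiffOn ℝ (⊤ : ℕ∞) (fun q => T q v w) D.U)
    (hν : ContDiffOn ℝ (⊤ : ℕ∞) ν D.U)
    (hρ : ContDiffOn ℝ (⊤ : ℕ∞) (fun q => σ q + φ q) D.U)
    (hform : ∀ q ∈ D.U, ∀ w u,
      T q w u = σ q * D.g q w u + φ q * (D.g q (ν q) w * D.g q (ν q) u))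
    (hp : p ∈ D.U) : ContDiffAt ℝ (⊤ : ℕ∞) σ p := by
  have hUp := D.hU.mem_nhds hp
  obtain ⟨z, hz0, hz, -⟩ := D.exists_ne_zero_orthogonal (p := p) hn (ν p) (ν p)
  have hη := (D.contDiffOn_g_field hν z).contDiffAt hUp
  have hd : ContDiffAt ℝ (⊤ : ℕ∞) (fun q => D.g q z z - D.g q (ν q) z ^ 2) p :=
    ((D.g_smooth z z).contDiffAt hUp).sub (hη.pow 2)
  have hnum : ContDiffAt ℝ (⊤ : ℕ∞)
      (fun q => T q z z - (σ q + φ q) * D.g q (ν q) z ^ 2) p :=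
    ((hTsm z z).contDiffAt hUp).sub ((hρ.contDiffAt hUp).mul (hη.pow 2))
  have hdp : D.g p z z - D.g p (ν p) z ^ 2 ≠ 0 := by
    rw [hz]
    have := D.g_posdef p hp z hz0
    nlinarith
  refine (hnum.div hd hdp).congr_of_eventuallyEq ?_
  filter_upwards [hUp, hd.continuousAt.eventually_ne hdp] with q hq hdq
  rw [Pi.div_apply, eq_div_iff hdq, hform q hq z z]
  ring

theorem covDeriv2_of_eq_smul_g_add
    (hν : ContDiffOn ℝ (⊤ : ℕ∞) ν D.U)
    (hσ : DifferentiableAt ℝ σ p) (hφ : DifferentiableAt ℝ φ p)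
    (hform : ∀ q ∈ D.U, ∀ w u,
      T q w u = σ q * D.g q w u + φ q * (D.g q (ν q) w * D.g q (ν q) u))
    (hp : p ∈ D.U) (v w u : E n) :
    D.covDeriv2 T p v w u = fderiv ℝ σ p v * D.g p w u
      + fderiv ℝ φ p v * (D.g p (ν p) w * D.g p (ν p) u)
      + φ p * (D.g p (D.covDeriv ν p v) w * D.g p (ν p) u
        + D.g p (ν p) w * D.g p (D.covDeriv ν p v) u) := by
  have hUp := D.hU.mem_nhds hp
  have hη : ∀ w, DifferentiableAt ℝ (fun q => D.g q (ν q) w) p := fun w =>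
    ((D.contDiffOn_g_field hν w).contDiffAt hUp).differentiableAt (by simp)
  have hg : DifferentiableAt ℝ (fun q => D.g q w u) p :=
    ((D.g_smooth w u).contDiffAt hUp).differentiableAt (by simp)
  have he : (fun q => T q w u) =ᶠ[nhds p] fun q =>
      σ q * D.g q w u + φ q * (D.g q (ν q) w * D.g q (ν q) u) := by
    filter_upwards [hUp] with q hq using hform q hq w u
  have hder := (hσ.hasFDerivAt.fun_mul hg.hasFDerivAt).fun_add
    (hφ.hasFDerivAt.fun_mul ((hη w).hasFDerivAt.fun_mul (hη u).hasFDerivAt))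
  have hder' := DFunLike.congr_fun (he.fderiv_eq.trans hder.fderiv) v
  simp only [add_apply, smul_apply, smul_eq_mul,
    D.compat p hp, D.fderiv_g_field hν hp] at hder'
  rw [covDeriv2, hder', hform p hp, hform p hp]
  ring

end SpectralForm

end RiemannChart

/-- If a Codazzi tensor `T` on `(Mⁿ,g)`, `n ≥ 3`, has at every point
exactly two distinct eigenvalues `ρ` and `σ` of multiplicities `1` and `n-1`, then the
mean curvature `H` of the (totally umbilical) integral leaves of the eigendistribution
`V_σ` is constant along every connected component of each leaf; locally: the derivative
of `H` in any direction tangent to `V_σ` vanishes. -/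
theorem codazzi_two_eigenvalues_mean_curvature_constant_on_leaves
    {n : ℕ} (hn : 3 ≤ n) (D : RiemannChart n)
    (T : E n → E n → E n → ℝ) (ρ σ : E n → ℝ)
    (hT : D.IsCodazzi T) (h2 : D.HasTwoEigenvalues T ρ σ)
    (ν : E n → E n) (H : E n → ℝ)
    (hν_smooth : ContDiffOn ℝ (⊤ : ℕ∞) ν D.U)
    (hν_unit : ∀ p ∈ D.U, D.g p (ν p) (ν p) = 1)
    (hν_eig : ∀ p ∈ D.U, ν p ∈ D.eigenSet T p (ρ p))
    (hH : DifferentiableOn ℝ H D.U)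
    (humb : ∀ p ∈ D.U, ∀ v ∈ D.eigenSet T p (σ p), ∀ w ∈ D.eigenSet T p (σ p),
      D.g p (D.covDeriv ν p v) w = (H p / ((n : ℝ) - 1)) * D.g p v w) :
    ∀ p ∈ D.U, ∀ v ∈ D.eigenSet T p (σ p), fderiv ℝ H p v = 0 := by
  obtain ⟨hTs, hTl, hTsm, hTc⟩ := hT
  obtain ⟨hne, -, hmult⟩ := h2
  set φ : E n → ℝ := fun q => ρ q - σ q with hφdef
  have hker : ∀ q ∈ D.U, ∀ w, w ∈ D.eigenSet T q (σ q) ↔ D.g q (ν q) w = 0 := fun q hq =>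
    D.mem_eigenSet_iff_of_eigenMult (hTs q hq) (hTl q hq) (hne q hq) (hmult q hq)
      (hν_eig q hq) (hν_unit q hq)
  have hform : ∀ q ∈ D.U, ∀ w u,
      T q w u = σ q * D.g q w u + φ q * (D.g q (ν q) w * D.g q (ν q) u) := fun q hq =>
    D.eq_smul_g_add_smul_flat (hTl q hq) (hν_eig q hq) (hν_unit q hq)
      fun w hw => (hker q hq w).mpr hw
  have hρ : ContDiffOn ℝ (⊤ : ℕ∞) (fun q => σ q + φ q) D.U := by
    have hTν : ∀ w, ContDiffOn ℝ (⊤ : ℕ∞) (fun q => T q (ν q) w) D.U := fun w =>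
      RiemannChart.contDiffOn_apply_field (G := fun q u => T q u w)
        (fun q hq a u v => hTl q hq a u v w) (fun v => hTsm v w) hν_smooth
    refine (RiemannChart.contDiffOn_apply_field (G := fun q u => T q (ν q) u)
      (fun q hq a u v => ?_) hTν hν_smooth).congr fun q hq => ?_
    · rw [hTs q hq, hTl q hq, hTs q hq u, hTs q hq v]
    · rw [hν_eig q hq (ν q), hν_unit q hq]
      simp [hφdef]
  have hσ : ∀ q ∈ D.U, ContDiffAt ℝ (⊤ : ℕ∞) σ q := fun q hq =>
    D.contDiffAt_of_eq_smul_g_add hn hTsm hν_smooth hρ hform hq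
  have hσd : ∀ q ∈ D.U, DifferentiableAt ℝ σ q := fun q hq =>
    (hσ q hq).differentiableAt (by simp)
  have hφd : ∀ q ∈ D.U, DifferentiableAt ℝ φ q := fun q hq => by
    have h := ((hρ.contDiffAt (D.hU.mem_nhds hq)).sub (hσ q hq)).differentiableAt (by simp)
    simpa [Pi.sub_def] using h
  have hB := fun q (hq : q ∈ D.U) => D.g_covDeriv_self_eq_zero hν_smooth hν_unit hq
  have hC : ∀ q ∈ D.U, ∀ v w u,
      fderiv ℝ σ q v * D.g q w u
          + fderiv ℝ φ q v * (D.g q (ν q) w * D.g q (ν q) u)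
          + φ q * (D.g q (D.covDeriv ν q v) w * D.g q (ν q) u
            + D.g q (ν q) w * D.g q (D.covDeriv ν q v) u)
        = fderiv ℝ σ q w * D.g q v u
          + fderiv ℝ φ q w * (D.g q (ν q) v * D.g q (ν q) u)
          + φ q * (D.g q (D.covDeriv ν q w) v * D.g q (ν q) u
            + D.g q (ν q) v * D.g q (D.covDeriv ν q w) u) := fun q hq v w u => by
    rw [← D.covDeriv2_of_eq_smul_g_add hν_smooth (hσd q hq) (hφd q hq) hform hq,
      ← D.covDeriv2_of_eq_smul_g_add hν_smooth (hσd q hq) (hφd q hq) hform hq]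
    exact hTc q hq v w u
  have hσV : ∀ q ∈ D.U, ∀ v, D.g q (ν q) v = 0 → fderiv ℝ σ q v = 0 := by
    intro q hq v hv
    obtain ⟨z, hz0, hνz, hvz⟩ := D.exists_ne_zero_orthogonal (p := q) hn (ν q) v
    have h := hC q hq v z z
    rw [hνz, hv, hvz] at h
    have hpos := D.g_posdef q hq z hz0
    have h' : fderiv ℝ σ q v * D.g q z z = 0 := by linarith
    exact (mul_eq_zero.mp h').resolve_right hpos.ne'
  have hσν : ∀ q ∈ D.U, fderiv ℝ σ q (ν q) = H q / ((n : ℝ) - 1) * φ q := by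
    intro q hq
    obtain ⟨z, hz0, hνz, -⟩ := D.exists_ne_zero_orthogonal (p := q) hn (ν q) (ν q)
    have h := hC q hq (ν q) z z
    have hz := (hker q hq z).mpr hνz
    rw [humb q hq z hz z hz, hσV q hq z hνz, hνz, hν_unit q hq] at h
    have hpos := D.g_posdef q hq z hz0
    apply mul_right_cancel₀ hpos.ne'
    linarith
  have hdσ : ∀ q ∈ D.U, ∀ w,
      fderiv ℝ σ q w = H q / ((n : ℝ) - 1) * φ q * D.g q (ν q) w := by
    intro q hq w
    have h := hσV q hq _ (D.sub_smul_orthogonal (hν_unit q hq) w)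
    rw [map_sub, map_smul, hσν q hq, smul_eq_mul] at h
    linarith
  intro p hp v hv
  have hUp := D.hU.mem_nhds hp
  have hHd : DifferentiableAt ℝ H p := hH.differentiableAt hUp
  have hνv : D.g p (ν p) v = 0 := (hker p hp v).mp hv
  have hηd : ∀ w, DifferentiableAt ℝ (fun q => D.g q (ν q) w) p := fun w =>
    ((D.contDiffOn_g_field hν_smooth w).contDiffAt hUp).differentiableAt (by simp)
  have h_two : (2 : WithTop ℕ∞) ≤ ((⊤ : ℕ∞) : WithTop ℕ∞) := by
    change ((2 : ℕ∞) : WithTop ℕ∞) ≤ _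
    exact WithTop.coe_le_coe.mpr le_top
  have hσ2 : DifferentiableAt ℝ (fderiv ℝ σ) p :=
    ((hσ p hp).fderiv_right (m := 1) (by rwa [one_add_one_eq_two])).differentiableAt (by simp)
  have hsnd : ∀ x w, fderiv ℝ (fderiv ℝ σ) p x w
      = fderiv ℝ H p x / ((n : ℝ) - 1) * φ p * D.g p (ν p) w
        + H p / ((n : ℝ) - 1) * fderiv ℝ φ p x * D.g p (ν p) w
        + H p / ((n : ℝ) - 1) * φ p
          * (D.g p (D.covDeriv ν p x) w + D.g p (ν p) (D.Γ p x w)) := by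
    intro x w
    have he : (fun q => fderiv ℝ σ q w) =ᶠ[nhds p]
        fun q => H q * ((n : ℝ) - 1)⁻¹ * φ q * D.g q (ν q) w := by
      filter_upwards [hUp] with q hq
      rw [hdσ q hq w, div_eq_mul_inv]
    have hl := hσ2.hasFDerivAt.clm_apply (hasFDerivAt_const w p)
    have hr := ((hHd.hasFDerivAt.mul_const ((n : ℝ) - 1)⁻¹).fun_mul (hφd p hp).hasFDerivAt).fun_mul
      (hηd w).hasFDerivAt
    have h := DFunLike.congr_fun (hl.fderiv.symm.trans (he.fderiv_eq.trans hr.fderiv)) x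
    simp only [add_apply, smul_apply, smul_eq_mul,
      D.fderiv_g_field hν_smooth hp, ContinuousLinearMap.flip_apply,
      ContinuousLinearMap.comp_apply, zero_apply, map_zero, zero_add] at h
    rw [h]
    ring
  have hsymm : fderiv ℝ (fderiv ℝ σ) p v (ν p) = fderiv ℝ (fderiv ℝ σ) p (ν p) v :=
    ((hσ p hp).isSymmSndFDerivAt (by simpa using h_two)).eq v (ν p)
  rw [hsnd, hsnd, hνv, hν_unit p hp, hB p hp, D.Γ_symm p v (ν p)] at hsymm
  have hφv : fderiv ℝ φ p v = φ p * D.g p (D.covDeriv ν p (ν p)) v := by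
    have h := hC p hp (ν p) v (ν p)
    rw [D.g_symm p v (ν p), hνv, hν_unit p hp, hB p hp, hB p hp, hσV p hp v hνv] at h
    linarith
  rw [hφv] at hsymm
  have hφ0 : φ p ≠ 0 := sub_ne_zero.mpr (hne p hp)
  have hn1 : (n : ℝ) - 1 ≠ 0 := by
    have : (3 : ℝ) ≤ n := by exact_mod_cast hn
    linarith
  have h0 : fderiv ℝ H p v / ((n : ℝ) - 1) * φ p = 0 := by linarith
  simpa [hφ0, hn1] using h0

end
end

section
/- Let M = ℝ × S¹ × S¹ with coordinates (t, x, y), let σ: ℝ → ℝ⁺ and ρ: M → ℝ be smooth functions with σ(t) ≠ ρ(t,x,y) everywhere, and endow M with the Riemannian metric g = (σ(t) − ρ(t,x,y))⁻² dt² + σ(t) dx² + σ(t) dy². Define the symmetric (1,1)-tensor T by T(∂_t) = ρ ∂_t, T(∂_x) = σ ∂_x, T(∂_y) = σ ∂_y. Then all components of ∇T obstructing the Codazzi equation vanish identically except ∇_t T_{xx} − ∇_x T_{tx} = (3σ − ρ) σ′ / 2 (and symmetrically in y); in particular, T is a Codazzi tensor if and only if (3σ(t) − ρ(t,x,y)) σ′(t)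 = 0 for all (t,x,y) ∈ M. -/
noncomputable section

open scoped RealInnerProductSpace

lemma hasFDerivAt_comp_fst_coord {σ : ℝ → ℝ} {p : E 3} (hσ : DifferentiableAt ℝ σ (p 0)) :
    HasFDerivAt (fun q : E 3 => σ (q 0))
      (deriv σ (p 0) • (EuclideanSpace.proj 0 : E 3 →L[ℝ] ℝ)) p :=
  hσ.hasDerivAt.comp_hasFDerivAt p (EuclideanSpace.proj (𝕜 := ℝ) (0 : Fin 3)).hasFDerivAt

/-- The derivative of a diagonal bilinear form `a dt² + b (dx² + dy²)` evaluated on constant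
vector fields. -/
lemma fderiv_diagonal_form {B : E 3 → E 3 → E 3 → ℝ} {a b : E 3 → ℝ} {a' b' : E 3 →L[ℝ] ℝ}
    {p : E 3}
    (hB : ∀ q v w, B q v w = a q * (v 0 * w 0) + b q * (v 1 * w 1) + b q * (v 2 * w 2))
    (ha : HasFDerivAt a a' p) (hb : HasFDerivAt b b' p) (v w u : E 3) :
    fderiv ℝ (fun q => B q w u) p v =
      a' v * (w 0 * u 0) + b' v * (w 1 * u 1) + b' v * (w 2 * u 2) := by
  have h := ((ha.mul_const (w 0 * u 0)).add (hb.mul_const (w 1 * u 1))).add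
    (hb.mul_const (w 2 * u 2))
  have hfun : (fun q => B q w u) = fun q =>
      a q * (w 0 * u 0) + b q * (w 1 * u 1) + b q * (w 2 * u 2) := funext fun q => hB q w u
  rw [hfun]
  refine (congrArg (fun L : E 3 →L[ℝ] ℝ => L v) h.fderiv).trans ?_
  simp only [add_apply, smul_apply, smul_eq_mul]
  ring

namespace RiemannChart

/-- The Koszul formula for constant vector fields. -/
lemma two_mul_g_Γ {n : ℕ} (D : RiemannChart n) {p : E n} (hp : p ∈ D.U) (v w u : E n) :
    2 * D.g p (D.Γ p v w) u =
      fderiv ℝ (fun q => D.g q w u) p v + fderiv ℝ (fun q => D.g q v u) p w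
        - fderiv ℝ (fun q => D.g q v w) p u := by
  rw [D.compat p hp v w u, D.compat p hp w v u, D.compat p hp u v w, D.Γ_symm p w v,
    D.Γ_symm p u v, D.Γ_symm p u w, D.g_symm p w, D.g_symm p v (D.Γ p w u)]
  ring

end RiemannChart

/-- The Codazzi defect of `T` on arbitrary vectors. -/
lemma covDeriv2_sub_covDeriv2_swap
    {σ : ℝ → ℝ} {ρ : E 3 → ℝ} (D : RiemannChart 3) {p : E 3} (hp : p ∈ D.U)
    (hσ : DifferentiableAt ℝ σ (p 0)) (hρ : DifferentiableAt ℝ ρ p) (hne : σ (p 0) ≠ ρ p)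
    (hg : ∀ p v w : E 3, D.g p v w =
      (σ (p 0) - ρ p)⁻¹ ^ 2 * (v 0 * w 0) + σ (p 0) * (v 1 * w 1) + σ (p 0) * (v 2 * w 2))
    {T : E 3 → E 3 → E 3 → ℝ}
    (hT : ∀ p v w : E 3, T p v w =
      ρ p / (σ (p 0) - ρ p) ^ 2 * (v 0 * w 0)
        + σ (p 0) ^ 2 * (v 1 * w 1) + σ (p 0) ^ 2 * (v 2 * w 2)) (v w u : E 3) :
    D.covDeriv2 T p v w u - D.covDeriv2 T p w v u =
      (3 * σ (p 0) - ρ p) * deriv σ (p 0) / 2 *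
        (v 0 * (w 1 * u 1 + w 2 * u 2) - w 0 * (v 1 * u 1 + v 2 * u 2)) := by
  have hd : σ (p 0) - ρ p ≠ 0 := sub_ne_zero.mpr hne
  have hs := hasFDerivAt_comp_fst_coord hσ
  have hR := hρ.hasFDerivAt
  have hinv := (hasDerivAt_inv hd).comp_hasFDerivAt p (hs.sub hR)
  have hinv2 := hinv.pow 2
  have hdg := fderiv_diagonal_form hg hinv2 hs
  have hdT := fderiv_diagonal_form (B := T)
    (a := fun q => ρ q * (σ (q 0) - ρ q)⁻¹ ^ 2) (b := fun q => σ (q 0) ^ 2)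
    (fun q v w => by rw [hT, div_eq_mul_inv, inv_pow]) (hR.mul hinv2) (hs.pow 2)
  have hTg : ∀ x y : E 3, T p x y =
      σ (p 0) * D.g p x y - (σ (p 0) - ρ p) * D.g p x (y 0 • e 3 0) := by
    intro x y
    rw [hT, hg, hg]
    simp [e]
    field_simp
    ring
  have hTsymm : ∀ x y : E 3, T p x y = T p y x := by
    intro x y
    rw [hT, hT]
    ring
  have hΓ : ∀ x y z : E 3, D.g p (D.Γ p x y) z =
      (fderiv ℝ (fun q => D.g q y z) p x + fderiv ℝ (fun q => D.g q x z) p y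
        - fderiv ℝ (fun q => D.g q x y) p z) / 2 := by
    intro x y z
    rw [← D.two_mul_g_Γ hp x y z]
    ring
  unfold RiemannChart.covDeriv2
  rw [D.Γ_symm p w v, hTsymm w (D.Γ p v u), hTsymm v (D.Γ p w u), hTg (D.Γ p v u),
    hTg (D.Γ p w u)]
  simp only [hΓ, hdg, hdT]
  simp [e]
  field_simp
  ring

/-- On `M = ℝ × S¹ × S¹` (coordinates `(t,x,y)`, encoded here by the
chart `ℝ³` with `ρ` periodic in `x` and `y`), with metric
`g = (σ(t) - ρ)⁻² dt² + σ dx² + σ dy²` and the symmetric tensor `T` with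
`T(∂t) = ρ ∂t`, `T(∂x) = σ ∂x`, `T(∂y) = σ ∂y` (whose `(0,2)`-form is
`T_tt = ρ/(σ-ρ)²`, `T_xx = T_yy = σ²`), all the components of `∇T` obstructing the
Codazzi equation vanish identically except
`∇_t T_xx - ∇_x T_tx = (3σ - ρ)σ'/2` (and symmetrically in `y`); in particular `T` is
a Codazzi tensor if and only if `(3σ(t) - ρ(t,x,y)) σ'(t) = 0` everywhere. -/
theorem merton_type_example_codazzi_iff
    (σ : ℝ → ℝ) (ρ : E 3 → ℝ)
    (hσ : ContDiff ℝ (⊤ : ℕ∞) σ) (hρ : ContDiff ℝ (⊤ : ℕ∞) ρ)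
    (hσpos : ∀ t, 0 < σ t)
    (hne : ∀ p : E 3, σ (p 0) ≠ ρ p)
    (hper_x : ∀ (p : E 3) (k : ℤ), ρ (p + (k : ℝ) • e 3 1) = ρ p)
    (hper_y : ∀ (p : E 3) (k : ℤ), ρ (p + (k : ℝ) • e 3 2) = ρ p)
    (D : RiemannChart 3) (hU : D.U = Set.univ)
    (hg : ∀ p v w : E 3, D.g p v w =
      (σ (p 0) - ρ p)⁻¹ ^ 2 * (v 0 * w 0) + σ (p 0) * (v 1 * w 1) + σ (p 0) * (v 2 * w 2))
    (T : E 3 → E 3 → E 3 → ℝ)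
    (hTdef : ∀ p v w : E 3, T p v w =
      ρ p / (σ (p 0) - ρ p) ^ 2 * (v 0 * w 0)
        + σ (p 0) ^ 2 * (v 1 * w 1) + σ (p 0) ^ 2 * (v 2 * w 2)) :
    (∀ p : E 3, ∀ i j k : Fin 3,
      D.covDeriv2 T p (e 3 i) (e 3 j) (e 3 k) - D.covDeriv2 T p (e 3 j) (e 3 i) (e 3 k) =
        (if i = 0 ∧ j = k ∧ j ≠ 0 then (3 * σ (p 0) - ρ p) * deriv σ (p 0) / 2 else 0) -
        (if j = 0 ∧ i = k ∧ i ≠ 0 then (3 * σ (p 0) - ρ p) * deriv σ (p 0) / 2 else 0)) ∧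
    (D.IsCodazzi T ↔ ∀ p : E 3, (3 * σ (p 0) - ρ p) * deriv σ (p 0) = 0) := by
  have hσd := hσ.differentiable (by simp)
  have hρd := hρ.differentiable (by simp)
  have key : ∀ p v w u : E 3, D.covDeriv2 T p v w u - D.covDeriv2 T p w v u =
      (3 * σ (p 0) - ρ p) * deriv σ (p 0) / 2 *
        (v 0 * (w 1 * u 1 + w 2 * u 2) - w 0 * (v 1 * u 1 + v 2 * u 2)) := fun p =>
    covDeriv2_sub_covDeriv2_swap D (by simp [hU]) (hσd _) (hρd _) (hne p) hg hTdef
  refine ⟨fun p i j k => ?_, fun h p => ?_, fun h => ⟨?_, ?_, ?_, ?_⟩⟩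
  · rw [key]
    fin_cases i <;> fin_cases j <;> fin_cases k <;> simp [e]
  · have h₁ := key p (e 3 0) (e 3 1) (e 3 1)
    rw [h.2.2.2 p (by simp [hU]), sub_self] at h₁
    simp [e] at h₁
    linarith
  · intro p _ v w
    rw [hTdef, hTdef]
    ring
  · intro p _ a u v w
    simp only [hTdef, PiLp.add_apply, PiLp.smul_apply, smul_eq_mul]
    ring
  · intro v w
    have hs : ContDiff ℝ (⊤ : ℕ∞) fun q : E 3 => σ (q 0) :=
      hσ.comp (EuclideanSpace.proj (𝕜 := ℝ) (0 : Fin 3)).contDiff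
    simp only [hTdef]
    refine ContDiff.contDiffOn ?_
    exact (((hρ.div ((hs.sub hρ).pow 2)
      fun q => pow_ne_zero 2 (sub_ne_zero.mpr (hne q))).mul contDiff_const).add
      ((hs.pow 2).mul contDiff_const)).add ((hs.pow 2).mul contDiff_const)
  · intro p _ v w u
    rw [← sub_eq_zero, key, h p]
    ring

end
end
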